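/- arXiv:2507.21877 — 2 statements merged into one kernel-verified Lean document; each statement's English description precedes it below -/
import Mathlib

section
/- For each natural number n > 0 there is a quasi-embedding from B^l_{n+1,X} into the partial order (B^l_{n,X})^* of finite sequences over B^l_{n,X} with Higman's embedding order. Consequently o(B^l_{n+1,1}) ≤ ω^(ω^(o(B^l_{n,1}))). -/
/-- Binary trees with leaf labels in `X` and inner labels in `ℕ`. -/
inductive LTree (X : Type*) where
  | leaf (x : X)
  | node (b : ℕ) (l r : LTree X)

/-- The infimum-preserving embeddability relation on such binary trees. -/
inductive LTree.Le {X : Type*} [PartialOrder X] : LTree X → LTree X → Prop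
  | leaf {x y : X} : x ≤ y → LTree.Le (.leaf x) (.leaf y)
  | left {s : LTree X} {γ : ℕ} {tl tr : LTree X} :
      LTree.Le s tl → LTree.Le s (.node γ tl tr)
  | right {s : LTree X} {γ : ℕ} {tl tr : LTree X} :
      LTree.Le s tr → LTree.Le s (.node γ tl tr)
  | node {β γ : ℕ} {sl sr tl tr : LTree X} :
      β ≤ γ → LTree.Le sl tl → LTree.Le sr tr →
        LTree.Le (.node β sl sr) (.node γ tl tr)

/-- The inner labels of a tree. -/
def LTree.innerLabels {X : Type*} : LTree X → List ℕ
  | .leaf _ => []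
  | .node b l r => b :: (l.innerLabels ++ r.innerLabels)

/-- Weakly ascending inner labels, ascending strictly on left subtrees. -/
def LTree.IsBl {X : Type*} : LTree X → Prop
  | .leaf _ => True
  | .node b l r =>
      (∀ x ∈ l.innerLabels, b < x) ∧ (∀ x ∈ r.innerLabels, b ≤ x) ∧
        l.IsBl ∧ r.IsBl

/-- All inner labels lie below `n`, i.e. the tree has labels in `{0, …, n-1}`. -/
def LTree.BoundedBy {X : Type*} (n : ℕ) (t : LTree X) : Prop :=
  ∀ x ∈ t.innerLabels, x < n

/-- The maximal order type of a (well) partial order: the supremum of all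
ordinals that quasi-embed into it. -/
noncomputable def motype {Y : Type*} (le : Y → Y → Prop) : Ordinal.{0} :=
  sSup {a : Ordinal.{0} |
    ∃ f : Set.Iio a → Y, ∀ x y : Set.Iio a, le (f x) (f y) → x ≤ y}

open Ordinal in
noncomputable def nad (a b : Ordinal.{0}) : Ordinal.{0} :=
  max (⨆ x : Set.Iio a, Order.succ (nad x.1 b)) (⨆ y : Set.Iio b, Order.succ (nad a y.1))
termination_by (a, b)
decreasing_by
  · exact Prod.Lex.left _ _ x.2
  · exact Prod.Lex.right _ y.2

theorem nad_lt_left {a a' : Ordinal.{0}} (h : a' < a) (b : Ordinal.{0}) : nad a' b < nad a b := by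
  rw [nad.eq_1 a b]
  refine lt_of_lt_of_le ?_ (le_max_left _ _)
  exact lt_of_lt_of_le (Order.lt_succ _)
    (Ordinal.le_iSup (fun x : Set.Iio a => Order.succ (nad x.1 b)) ⟨a', h⟩)

theorem nad_lt_right (a : Ordinal.{0}) {b b' : Ordinal.{0}} (h : b' < b) : nad a b' < nad a b := by
  rw [nad.eq_1 a b]
  refine lt_of_lt_of_le ?_ (le_max_right _ _)
  exact lt_of_lt_of_le (Order.lt_succ _)
    (Ordinal.le_iSup (fun x : Set.Iio b => Order.succ (nad a x.1)) ⟨b', h⟩)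

theorem nad_le {a b c : Ordinal.{0}} (h1 : ∀ x < a, nad x b < c) (h2 : ∀ y < b, nad a y < c) :
    nad a b ≤ c := by
  rw [nad.eq_1 a b]
  refine max_le (Ordinal.iSup_le ?_) (Ordinal.iSup_le ?_)
  · intro x; exact Order.succ_le_of_lt (h1 x.1 x.2)
  · intro x; exact Order.succ_le_of_lt (h2 x.1 x.2)

theorem nad_zero_le (a : Ordinal.{0}) : nad a 0 ≤ a := by
  induction a using WellFoundedLT.induction with
  | ind a ih =>
    refine nad_le (fun x hx => lt_of_le_of_lt (ih x hx) hx) (fun y hy => ?_)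
    exact absurd hy (not_lt_bot)

theorem zero_nad_le (a : Ordinal.{0}) : nad 0 a ≤ a := by
  induction a using WellFoundedLT.induction with
  | ind a ih =>
    refine nad_le (fun y hy => ?_) (fun x hx => lt_of_le_of_lt (ih x hx) hx)
    exact absurd hy (not_lt_bot)

theorem nad_le_nad {a b c d : Ordinal.{0}} (h1 : a ≤ c) (h2 : b ≤ d) : nad a b ≤ nad c d := by
  have A : nad a b ≤ nad c b := by
    rcases h1.lt_or_eq with h | h
    · exact (nad_lt_left h b).le
    · rw [h]
  have B : nad c b ≤ nad c d := by
    rcases h2.lt_or_eq with h | h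
    · exact (nad_lt_right c h).le
    · rw [h]
  exact A.trans B

theorem nad_nat (n m : ℕ) : nad n m ≤ ((n + m : ℕ) : Ordinal.{0}) := by
  induction n using Nat.strong_induction_on generalizing m with
  | _ n ihn =>
  induction m using Nat.strong_induction_on with
  | _ m ihm =>
    refine nad_le ?_ ?_
    · intro x hx
      obtain ⟨k, rfl⟩ := Ordinal.lt_omega0.1 (hx.trans (Ordinal.natCast_lt_omega0 n))
      have hk : k < n := by exact_mod_cast hx
      refine lt_of_le_of_lt (ihn k hk m) ?_
      exact_mod_cast (by omega : k + m < n + m)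
    · intro x hx
      obtain ⟨k, rfl⟩ := Ordinal.lt_omega0.1 (hx.trans (Ordinal.natCast_lt_omega0 m))
      have hk : k < m := by exact_mod_cast hx
      refine lt_of_le_of_lt (ihm k hk) ?_
      exact_mod_cast (by omega : n + k < n + m)

theorem nad_split {w : Ordinal.{0}} (hw : ∀ x < w, ∀ y < w, nad x y < w) (h0 : w ≠ 0)
    (p q x y : Ordinal.{0}) (hx : x < w) (hy : y < w) :
    nad (w * p + x) (w * q + y) ≤ w * nad p q + nad x y := by
  have key : ∀ a b : Ordinal.{0}, ∀ p q x y : Ordinal.{0}, x < w → y < w →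
      a = w * p + x → b = w * q + y → nad a b ≤ w * nad p q + nad x y := by
    intro a
    induction a using WellFoundedLT.induction with
    | ind a iha =>
    intro b
    induction b using WellFoundedLT.induction with
    | ind b ihb =>
    intro p q x y hx hy ha hb
    refine nad_le ?_ ?_
    · intro c hc
      have hcm := Ordinal.mod_lt c h0
      have hcd := Ordinal.div_add_mod c w
      have := iha c hc b (c / w) q (c % w) y hcm hy hcd.symm hb
      refine lt_of_le_of_lt this ?_
      rcases lt_trichotomy (c / w) p with h | h | h
      · calc w * nad (c / w) q + nad (c % w) y < w * nad (c / w) q + w := by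
              gcongr; exact hw _ hcm _ hy
          _ = w * Order.succ (nad (c / w) q) := by rw [Ordinal.mul_succ]
          _ ≤ w * nad p q := by
              gcongr; exact Order.succ_le_of_lt (nad_lt_left h q)
          _ ≤ _ := le_self_add
      · rw [h]
        gcongr
        apply nad_lt_left
        rw [ha, ← hcd, h] at hc
        exact lt_of_add_lt_add_left hc
      · exfalso
        refine absurd hc (not_lt.2 ?_)
        calc a ≤ w * p + w := by rw [ha]; gcongr
          _ = w * Order.succ p := by rw [Ordinal.mul_succ]
          _ ≤ w * (c / w) := by gcongr; exact Order.succ_le_of_lt h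
          _ ≤ c := Ordinal.mul_div_le _ _
    · intro c hc
      have hcm := Ordinal.mod_lt c h0
      have hcd := Ordinal.div_add_mod c w
      have := ihb c hc p (c / w) x (c % w) hx hcm ha hcd.symm
      refine lt_of_le_of_lt this ?_
      rcases lt_trichotomy (c / w) q with h | h | h
      · calc w * nad p (c / w) + nad x (c % w) < w * nad p (c / w) + w := by
              gcongr; exact hw _ hx _ hcm
          _ = w * Order.succ (nad p (c / w)) := by rw [Ordinal.mul_succ]
          _ ≤ w * nad p q := by
              gcongr; exact Order.succ_le_of_lt (nad_lt_right p h)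
          _ ≤ _ := le_self_add
      · rw [h]
        gcongr
        apply nad_lt_right
        rw [hb, ← hcd, h] at hc
        exact lt_of_add_lt_add_left hc
      · exfalso
        refine absurd hc (not_lt.2 ?_)
        calc b ≤ w * q + w := by rw [hb]; gcongr
          _ = w * Order.succ q := by rw [Ordinal.mul_succ]
          _ ≤ w * (c / w) := by gcongr; exact Order.succ_le_of_lt h
          _ ≤ c := Ordinal.mul_div_le _ _
  exact key _ _ p q x y hx hy rfl rfl

theorem nad_principal (d : Ordinal.{0}) :
    ∀ x < Ordinal.omega0 ^ d, ∀ y < Ordinal.omega0 ^ d, nad x y < Ordinal.omega0 ^ d := by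
  induction d using Ordinal.limitRecOn with
  | zero =>
    intro x hx y hy
    simp only [Ordinal.opow_zero, Order.lt_one_iff] at *
    subst hx hy
    have := nad_zero_le 0
    exact le_antisymm this bot_le
  | add_one d ih =>
    intro x hx y hy
    rw [← Order.succ_eq_add_one, Ordinal.opow_succ] at *
    have h0 : Ordinal.omega0 ^ d ≠ 0 := by
      exact (Ordinal.opow_pos d Ordinal.omega0_pos).ne'
    have hxd := Ordinal.div_add_mod x (Ordinal.omega0 ^ d)
    have hyd := Ordinal.div_add_mod y (Ordinal.omega0 ^ d)
    have hxm := Ordinal.mod_lt x h0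
    have hym := Ordinal.mod_lt y h0
    obtain ⟨n, hn⟩ := Ordinal.lt_omega0.1 ((Ordinal.lt_mul_iff_div_lt h0).1 hx)
    obtain ⟨m, hm⟩ := Ordinal.lt_omega0.1 ((Ordinal.lt_mul_iff_div_lt h0).1 hy)
    rw [hn] at hxd
    rw [hm] at hyd
    rw [← hxd, ← hyd]
    refine lt_of_le_of_lt (nad_split ih h0 _ _ _ _ hxm hym) ?_
    calc _ < Ordinal.omega0 ^ d * nad n m + Ordinal.omega0 ^ d := by
          gcongr; exact ih _ hxm _ hym
      _ = Ordinal.omega0 ^ d * Order.succ (nad n m) := by rw [Ordinal.mul_succ]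
      _ ≤ Ordinal.omega0 ^ d * ((n + m + 1 : ℕ) : Ordinal) := by
          gcongr
          refine Order.succ_le_of_lt (lt_of_le_of_lt (nad_nat n m) ?_)
          exact_mod_cast Nat.lt_succ_self _
      _ ≤ _ := by gcongr; exact (Ordinal.natCast_lt_omega0 _).le
  | limit d hd ih =>
    intro x hx y hy
    have h0 : Ordinal.omega0 ≠ 0 := Ordinal.omega0_ne_zero
    obtain ⟨e1, h1, hx1⟩ := (Ordinal.lt_opow_of_isSuccLimit h0 hd).1 hx
    obtain ⟨e2, h2, hy2⟩ := (Ordinal.lt_opow_of_isSuccLimit h0 hd).1 hy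
    have hm : max e1 e2 < d := max_lt h1 h2
    refine lt_of_lt_of_le (ih _ hm x (hx1.trans_le ?_) y (hy2.trans_le ?_)) ?_
    · exact Ordinal.opow_le_opow_right Ordinal.omega0_pos (le_max_left _ _)
    · exact Ordinal.opow_le_opow_right Ordinal.omega0_pos (le_max_right _ _)
    · exact Ordinal.opow_le_opow_right Ordinal.omega0_pos hm.le

def RB {Y : Type} (r : Y → Y → Prop) (A : Set Y) (a : Ordinal.{0}) : Prop :=
  ∀ x ∈ A, ∃ b : Ordinal.{0}, ∃ _ : b < a, RB r {y | y ∈ A ∧ ¬ r x y} b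
termination_by a

theorem RB_mono {Y : Type} {r : Y → Y → Prop} {A : Set Y} {a b : Ordinal.{0}} (h : RB r A a)
    (hab : a ≤ b) : RB r A b := by
  rw [RB] at h ⊢
  intro x hx
  obtain ⟨c, hc, h'⟩ := h x hx
  exact ⟨c, hc.trans_le hab, h'⟩

/-- transfer along quasi-embeddings -/
theorem RB_qe {Y Z : Type} {r : Y → Y → Prop} {r' : Z → Z → Prop} (g : Y → Z) :
    ∀ (a : Ordinal.{0}) (A : Set Y) (B : Set Z), (∀ x ∈ A, g x ∈ B) →
      (∀ x ∈ A, ∀ y ∈ A, r' (g x) (g y) → r x y) → RB r' B a → RB r A a := by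
  intro a
  induction a using WellFoundedLT.induction with
  | ind a ih =>
    intro A B h1 h2 h
    rw [RB] at h ⊢
    intro x hx
    obtain ⟨c, hc, h'⟩ := h (g x) (h1 x hx)
    refine ⟨c, hc, ih c hc _ _ ?_ ?_ h'⟩
    · rintro y ⟨hy, hxy⟩
      exact ⟨h1 y hy, fun h => hxy (h2 x hx y hy h)⟩
    · rintro y ⟨hy, _⟩ z ⟨hz, _⟩
      exact h2 y hy z hz

theorem RB_sub {Y : Type} {r : Y → Y → Prop} {A B : Set Y} {a : Ordinal.{0}} (h : RB r B a)
    (hab : A ⊆ B) : RB r A a :=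
  RB_qe id a A B hab (fun _ _ _ _ h => h) h

theorem RB_empty {Y : Type} {r : Y → Y → Prop} {a : Ordinal.{0}} : RB r ∅ a := by
  rw [RB]; intro x hx; exact absurd hx (Set.notMem_empty x)

theorem RB_zero {Y : Type} {r : Y → Y → Prop} {A : Set Y} (h : RB r A 0) : A = ∅ := by
  rw [RB] at h
  refine Set.eq_empty_iff_forall_notMem.2 fun x hx => ?_
  obtain ⟨b, hb, _⟩ := h x hx
  exact absurd hb not_lt_bot

theorem RB_union {Y : Type} {r : Y → Y → Prop} : ∀ (a b : Ordinal.{0}) (A B : Set Y),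
    RB r A a → RB r B b → RB r (A ∪ B) (nad a b) := by
  intro a
  induction a using WellFoundedLT.induction with
  | ind a iha =>
  intro b
  induction b using WellFoundedLT.induction with
  | ind b ihb =>
  intro A B hA hB
  have eq : ∀ x, {y | y ∈ A ∪ B ∧ ¬ r x y} = {y | y ∈ A ∧ ¬ r x y} ∪ {y | y ∈ B ∧ ¬ r x y} := by
    intro x; ext y; simp only [Set.mem_union, Set.mem_ofPred_eq]; tauto
  rw [RB]
  rintro x (hx | hx)
  · have hA' := hA
    rw [RB] at hA'
    obtain ⟨c, hc, h⟩ := hA' x hx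
    refine ⟨nad c b, nad_lt_left hc b, ?_⟩
    rw [eq]
    exact iha c hc b _ _ h (RB_sub hB fun y hy => hy.1)
  · have hB' := hB
    rw [RB] at hB'
    obtain ⟨c, hc, h⟩ := hB' x hx
    refine ⟨nad a c, nad_lt_right a hc, ?_⟩
    rw [eq]
    exact ihb c hc _ _ (RB_sub hA fun y hy => hy.1) h

/-- lower bounds on the rank -/
def LB {Y : Type} (r : Y → Y → Prop) (A : Set Y) (a : Ordinal.{0}) : Prop :=
  ∀ b < a, ¬ RB r A b

theorem exists_exact {Y : Type} {r : Y → Y → Prop} {A : Set Y} {a : Ordinal.{0}}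
    (h : RB r A a) : ∃ b ≤ a, RB r A b ∧ LB r A b := by
  have hne : {b | RB r A b}.Nonempty := ⟨a, h⟩
  refine ⟨sInf {b | RB r A b}, csInf_le' h, csInf_mem hne, ?_⟩
  intro b hb hb'
  exact absurd hb (not_lt.2 (csInf_le' hb'))

/-- exact rank, downward closed -/
theorem exists_down {Y : Type} {r : Y → Y → Prop} (tr : ∀ a b c, r a b → r b c → r a c) :
    ∀ (a : Ordinal.{0}) (A : Set Y) (b : Ordinal.{0}), RB r A a → LB r A b →
      ∃ D ⊆ A, (∀ x ∈ A, ∀ y ∈ D, r x y → x ∈ D) ∧ RB r D b ∧ LB r D b := by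
  intro a
  induction a using WellFoundedLT.induction with
  | ind a ih =>
  intro A b hA hb
  by_cases h : RB r A b
  · exact ⟨A, subset_rfl, fun x hx _ _ _ => hx, h, hb⟩
  · have h' := h
    rw [RB] at h' hA
    push Not at h'
    obtain ⟨x, hx, hx'⟩ := h'
    obtain ⟨c, hc, hcR⟩ := hA x hx
    obtain ⟨D, hD, hdc, h1, h2⟩ := ih c hc _ b hcR (fun e he => hx' e he)
    refine ⟨D, fun y hy => (hD hy).1, ?_, h1, h2⟩
    intro y hy z hz hyz
    refine hdc y ⟨hy, fun hxy => (hD hz).2 (tr _ _ _ hxy hyz)⟩ z hz hyz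

theorem RB_diff {Y : Type} {r : Y → Y → Prop} : ∀ (c b : Ordinal.{0}) (A D : Set Y),
    RB r A (b + c) → D ⊆ A → (∀ x ∈ A, ∀ y ∈ D, r x y → x ∈ D) → LB r D b →
    RB r (A \ D) c := by
  intro c
  induction c using WellFoundedLT.induction with
  | ind c ih =>
  intro b A D hA hDA hdc hD
  rw [RB] at hA ⊢
  rintro x ⟨hx, hxD⟩
  obtain ⟨e, he, hR⟩ := hA x hx
  have hsub : D ⊆ {y | y ∈ A ∧ ¬ r x y} := fun y hy => ⟨hDA hy, fun h => hxD (hdc x hx y hy h)⟩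
  have hbe : b ≤ e := by
    by_contra hlt
    exact hD e (not_le.1 hlt) (RB_sub hR hsub)
  have hee := Ordinal.add_sub_cancel_of_le hbe
  have hlt : e - b < c := by
    rw [← hee] at he
    exact lt_of_add_lt_add_left he
  refine ⟨e - b, hlt, ?_⟩
  rw [← hee] at hR
  refine RB_sub (ih (e - b) hlt b _ D hR hsub (fun y hy => hdc y hy.1) hD) ?_
  rintro y ⟨⟨h1, h2⟩, h3⟩
  exact ⟨⟨h1, h3⟩, h2⟩

theorem RB_decomp {Y : Type} {r : Y → Y → Prop} (tr : ∀ a b c, r a b → r b c → r a c)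
    {A : Set Y} {b c : Ordinal.{0}} (h : RB r A (b + c)) :
    ∃ D E, A = D ∪ E ∧ RB r D b ∧ RB r E c := by
  by_cases hb : RB r A b
  · exact ⟨A, ∅, by simp, hb, RB_empty⟩
  · have hL : LB r A b := fun e he h' => hb (RB_mono h' he.le)
    obtain ⟨D, hDA, hdc, h1, h2⟩ := exists_down tr _ A b h hL
    refine ⟨D, A \ D, (Set.union_sdiff_cancel hDA).symm, h1, RB_diff c b A D h hDA hdc h2⟩

theorem ideal_ind {Y : Type} {r : Y → Y → Prop} (tr : ∀ a b c, r a b → r b c → r a c)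
    (d : Ordinal.{0}) (F : Set Y → Prop) (h0 : F ∅) (hU : ∀ A B, F A → F B → F (A ∪ B))
    (hI : ∀ e < d, ∀ A, RB r A (Ordinal.omega0 ^ e) → F A) :
    ∀ a < Ordinal.omega0 ^ d, ∀ A, RB r A a → F A := by
  intro a
  induction a using WellFoundedLT.induction with
  | ind a ih =>
  intro ha A hA
  by_cases h : a = 0
  · subst h
    rw [RB_zero hA]; exact h0
  · have h1 := Ordinal.opow_log_le_self Ordinal.omega0 h
    have h2 := Ordinal.lt_opow_succ_log_self Ordinal.one_lt_omega0 a
    have h3 := (Ordinal.lt_opow_iff_log_lt Ordinal.one_lt_omega0 h).1 ha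
    have h4 := Ordinal.add_sub_cancel_of_le h1
    have h5 : a - Ordinal.omega0 ^ Ordinal.log Ordinal.omega0 a < a := by
      refine lt_of_le_of_ne (Ordinal.sub_le_self _ _) fun heq => ?_
      rw [heq] at h4
      rw [Ordinal.add_eq_right_iff_mul_omega0_le, ← Ordinal.opow_succ] at h4
      exact absurd h2 (not_lt.2 h4)
    rw [← h4] at hA
    obtain ⟨D, E, rfl, hD, hE⟩ := RB_decomp tr hA
    exact hU _ _ (hI _ h3 _ hD) (ih _ h5 (h5.trans ha) _ hE)

def prel {Y Z : Type} (r : Y → Y → Prop) (r' : Z → Z → Prop) (p q : Y × Z) : Prop :=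
  r p.1 q.1 ∧ r' p.2 q.2

theorem RB_prod {Y Z : Type} {r : Y → Y → Prop} {r' : Z → Z → Prop}
    (tr : ∀ a b c, r a b → r b c → r a c) (tr' : ∀ a b c, r' a b → r' b c → r' a c) :
    ∀ (d e : Ordinal.{0}) (A : Set Y) (B : Set Z), RB r A (Ordinal.omega0 ^ d) →
      RB r' B (Ordinal.omega0 ^ e) → RB (prel r r') (A ×ˢ B) (Ordinal.omega0 ^ (nad d e)) := by
  intro d
  induction d using WellFoundedLT.induction with
  | ind d ihd =>
  intro e
  induction e using WellFoundedLT.induction with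
  | ind e ihe =>
  intro A B hA hB
  have hpr := nad_principal (nad d e)
  have hpos : 0 < Ordinal.omega0 ^ (nad d e) := Ordinal.opow_pos _ Ordinal.omega0_pos
  rw [RB]
  rintro ⟨x, z⟩ ⟨hx, hz⟩
  have hA' := hA
  have hB' := hB
  rw [RB] at hA' hB'
  obtain ⟨c1, hc1, h1⟩ := hA' x hx
  obtain ⟨c2, hc2, h2⟩ := hB' z hz
  have F1 := ideal_ind tr d (fun S => ∃ c < Ordinal.omega0 ^ (nad d e), RB (prel r r') (S ×ˢ B) c)
    ⟨0, hpos, by rw [Set.empty_prod]; exact RB_empty⟩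
    (by
      rintro S T ⟨c, hc, h⟩ ⟨c', hc', h'⟩
      exact ⟨nad c c', hpr c hc c' hc', by rw [Set.union_prod]; exact RB_union _ _ _ _ h h'⟩)
    (by
      intro d' hd' S hS
      exact ⟨_, (Ordinal.opow_lt_opow_iff_right Ordinal.one_lt_omega0).2 (nad_lt_left hd' e),
        ihd d' hd' e S B hS hB⟩) c1 hc1 _ h1
  have F2 := ideal_ind tr' e (fun S => ∃ c < Ordinal.omega0 ^ (nad d e), RB (prel r r') (A ×ˢ S) c)
    ⟨0, hpos, by rw [Set.prod_empty]; exact RB_empty⟩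
    (by
      rintro S T ⟨c, hc, h⟩ ⟨c', hc', h'⟩
      exact ⟨nad c c', hpr c hc c' hc', by rw [Set.prod_union]; exact RB_union _ _ _ _ h h'⟩)
    (by
      intro d' hd' S hS
      exact ⟨_, (Ordinal.opow_lt_opow_iff_right Ordinal.one_lt_omega0).2 (nad_lt_right d hd'),
        ihe d' hd' A S hA hS⟩) c2 hc2 _ h2
  obtain ⟨b1, hb1, g1⟩ := F1
  obtain ⟨b2, hb2, g2⟩ := F2
  refine ⟨nad b1 b2, hpr _ hb1 _ hb2, RB_sub (RB_union _ _ _ _ g1 g2) ?_⟩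
  rintro ⟨y, w⟩ ⟨⟨hy, hw⟩, hn⟩
  simp only [prel, not_and_or] at hn
  rcases hn with hn | hn
  · left; exact ⟨⟨hy, hn⟩, hw⟩
  · right; exact ⟨hy, ⟨hw, hn⟩⟩

theorem RB_prod' {Y Z : Type} {r : Y → Y → Prop} {r' : Z → Z → Prop}
    (tr : ∀ a b c, r a b → r b c → r a c) (tr' : ∀ a b c, r' a b → r' b c → r' a c)
    (g a b : Ordinal.{0}) (A : Set Y) (B : Set Z) (ha : a < Ordinal.omega0 ^ Ordinal.omega0 ^ g)
    (hb : b < Ordinal.omega0 ^ Ordinal.omega0 ^ g) (hA : RB r A a) (hB : RB r' B b) :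
    ∃ c < Ordinal.omega0 ^ Ordinal.omega0 ^ g, RB (prel r r') (A ×ˢ B) c := by
  have hpr := nad_principal (Ordinal.omega0 ^ g)
  have hpos : 0 < Ordinal.omega0 ^ Ordinal.omega0 ^ g := Ordinal.opow_pos _ Ordinal.omega0_pos
  refine ideal_ind tr (Ordinal.omega0 ^ g)
    (fun S => ∃ c < Ordinal.omega0 ^ Ordinal.omega0 ^ g, RB (prel r r') (S ×ˢ B) c)
    ⟨0, hpos, by rw [Set.empty_prod]; exact RB_empty⟩
    (by
      rintro S T ⟨c, hc, h⟩ ⟨c', hc', h'⟩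
      exact ⟨nad c c', hpr c hc c' hc', by rw [Set.union_prod]; exact RB_union _ _ _ _ h h'⟩)
    ?_ a ha A hA
  intro d hd S hS
  refine ideal_ind tr' (Ordinal.omega0 ^ g)
    (fun T => ∃ c < Ordinal.omega0 ^ Ordinal.omega0 ^ g, RB (prel r r') (S ×ˢ T) c)
    ⟨0, hpos, by rw [Set.prod_empty]; exact RB_empty⟩
    (by
      rintro S T ⟨c, hc, h⟩ ⟨c', hc', h'⟩
      exact ⟨nad c c', hpr c hc c' hc', by rw [Set.prod_union]; exact RB_union _ _ _ _ h h'⟩)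
    ?_ b hb B hB
  intro e he T hT
  exact ⟨_, (Ordinal.opow_lt_opow_iff_right Ordinal.one_lt_omega0).2 (nad_principal g d hd e he),
    RB_prod tr tr' d e S T hS hT⟩

theorem subl_append {Y : Type} {r : Y → Y → Prop} {a b c d : List Y}
    (h1 : List.SublistForall₂ r a b) (h2 : List.SublistForall₂ r c d) :
    List.SublistForall₂ r (a ++ c) (b ++ d) := by
  induction h1 with
  | @nil l =>
    induction l with
    | nil => simpa using h2
    | cons x l ih => exact List.SublistForall₂.cons_right ih
  | cons h _ ih => exact List.SublistForall₂.cons h ih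
  | cons_right _ ih => exact List.SublistForall₂.cons_right ih

theorem list_split {Y : Type} (p : Y → Prop) (v : List Y) :
    (∀ y ∈ v, ¬ p y) ∨ ∃ q : List Y × (Y × List Y), v = q.1 ++ q.2.1 :: q.2.2 ∧
      (∀ y ∈ q.1, ¬ p y) ∧ p q.2.1 := by
  induction v with
  | nil => left; simp
  | cons y v ih =>
    by_cases hy : p y
    · right; exact ⟨([], (y, v)), by simp, by simp, hy⟩
    · rcases ih with h | ⟨⟨q1, q2, q3⟩, h1, h2, h3⟩
      · left
        intro z hz
        rcases List.mem_cons.1 hz with rfl | hz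
        · exact hy
        · exact h z hz
      · right
        refine ⟨(y :: q1, (q2, q3)), by simp_all, ?_, h3⟩
        intro z hz
        rcases List.mem_cons.1 hz with rfl | hz
        · exact hy
        · exact h2 z hz

def Good (a : Ordinal.{0}) : Prop := ∀ b ≤ a, b < Ordinal.omega0 ^ b

theorem good_opow {a : Ordinal.{0}} (h : Good a) : Good (Ordinal.omega0 ^ a) := by
  intro b hb
  refine lt_of_le_of_ne (Ordinal.right_le_opow b Ordinal.one_lt_omega0) fun he => ?_
  rw [he] at hb
  have := (Ordinal.opow_le_opow_iff_right Ordinal.one_lt_omega0).1 hb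
  exact (h b this).ne he

theorem good_one : Good 1 := by
  intro b hb
  refine lt_of_le_of_ne (Ordinal.right_le_opow b Ordinal.one_lt_omega0) fun he => ?_
  rcases hb.lt_or_eq with h | h
  · rw [Order.lt_one_iff] at h
    subst h
    simp at he
  · subst h
    rw [Ordinal.opow_one] at he
    exact Ordinal.one_lt_omega0.ne he

theorem RB_higman {Y : Type} {r : Y → Y → Prop} (tr : ∀ a b c, r a b → r b c → r a c) :
    ∀ (a : Ordinal.{0}) (A : Set Y), Good a → RB r A a →
      RB (List.SublistForall₂ r) {l | ∀ x ∈ l, x ∈ A}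
        (Ordinal.omega0 ^ Ordinal.omega0 ^ a) := by
  have trL : ∀ a b c : List Y, List.SublistForall₂ r a b → List.SublistForall₂ r b c →
      List.SublistForall₂ r a c := by
    have : IsTrans Y r := ⟨tr⟩
    intro a b c h1 h2
    exact _root_.trans h1 h2
  have trP : ∀ a b c : Y × List Y, prel r (List.SublistForall₂ r) a b →
      prel r (List.SublistForall₂ r) b c → prel r (List.SublistForall₂ r) a c := by
    intro a b c h1 h2
    exact ⟨tr _ _ _ h1.1 h2.1, trL _ _ _ h1.2 h2.2⟩
  intro a
  induction a using WellFoundedLT.induction with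
  | ind a ih =>
  intro A ga hA
  have hpr := nad_principal (Ordinal.omega0 ^ a)
  have hpos : 0 < Ordinal.omega0 ^ Ordinal.omega0 ^ a := Ordinal.opow_pos _ Ordinal.omega0_pos
  have halt : a < Ordinal.omega0 ^ Ordinal.omega0 ^ a :=
    (ga a le_rfl).trans_le (Ordinal.right_le_opow _ Ordinal.one_lt_omega0)
  have main : ∀ w : List Y, (∀ x ∈ w, x ∈ A) → ∃ c < Ordinal.omega0 ^ Ordinal.omega0 ^ a,
      RB (List.SublistForall₂ r) {v | v ∈ {l : List Y | ∀ x ∈ l, x ∈ A} ∧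
        ¬ List.SublistForall₂ r w v} c := by
    intro w
    induction w with
    | nil =>
      intro _
      refine ⟨0, hpos, RB_sub RB_empty ?_⟩
      rintro v ⟨_, hv⟩
      exact hv List.SublistForall₂.nil
    | cons x w ihw =>
      intro hw
      obtain ⟨c1, hc1, R1⟩ := ihw fun y hy => hw y (List.mem_cons_of_mem _ hy)
      have hA' := hA
      rw [RB] at hA'
      obtain ⟨b, hb, Rb⟩ := hA' x (hw x List.mem_cons_self)
      have R2 := ih b hb _ (fun e he => ga e (he.trans hb.le)) Rb
      have hb2 : Ordinal.omega0 ^ Ordinal.omega0 ^ b < Ordinal.omega0 ^ Ordinal.omega0 ^ a :=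
        (Ordinal.opow_lt_opow_iff_right Ordinal.one_lt_omega0).2
          ((Ordinal.opow_lt_opow_iff_right Ordinal.one_lt_omega0).2 hb)
      obtain ⟨c3, hc3, R3⟩ := RB_prod' tr trL a a c1 _ _ halt hc1 hA R1
      obtain ⟨c4, hc4, R4⟩ := RB_prod' trL trP a _ c3 _ _ hb2 hc3 R2 R3
      let Q : Set (List Y) := {v | (∀ y ∈ v, y ∈ A) ∧ ¬ List.SublistForall₂ r (x :: w) v ∧
        ¬ ∀ y ∈ v, ¬ r x y}
      have hg : ∀ v : List Y, ∃ q : List Y × (Y × List Y), v ∈ Q →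
          v = q.1 ++ q.2.1 :: q.2.2 ∧ (∀ y ∈ q.1, ¬ r x y) ∧ r x q.2.1 := by
        intro v
        rcases list_split (r x) v with h | ⟨q, hq⟩
        · exact ⟨([], (x, [])), fun hv => absurd h hv.2.2⟩
        · exact ⟨q, fun _ => hq⟩
      choose g hg using hg
      have RQ : RB (List.SublistForall₂ r) Q c4 := by
        refine RB_qe g c4 _ _ ?_ ?_ R4
        · intro v hv
          obtain ⟨e1, e2, e3⟩ := hg v hv
          have hvA : ∀ y ∈ v, y ∈ A := hv.1
          have hvn : ¬ List.SublistForall₂ r (x :: w) v := hv.2.1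
          generalize g v = q at e1 e2 e3
          subst e1
          refine ⟨fun y hy => ⟨hvA y (by simp [hy]), e2 y hy⟩, hvA _ (by simp),
            fun y hy => hvA y (by simp [hy]), fun h => hvn ?_⟩
          exact subl_append (List.SublistForall₂.nil (l := q.1)) (List.SublistForall₂.cons e3 h)
        · intro u hu v hv h
          obtain ⟨e1, -, -⟩ := hg u hu
          obtain ⟨f1, -, -⟩ := hg v hv
          rw [e1, f1]
          exact subl_append h.1 (List.SublistForall₂.cons h.2.1 h.2.2)
      refine ⟨_, hpr _ hb2 _ hc4, RB_sub (RB_union _ _ _ _ R2 RQ) ?_⟩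
      rintro v ⟨hv1, hv2⟩
      by_cases h : ∀ y ∈ v, ¬ r x y
      · left; exact fun y hy => ⟨hv1 y hy, h y hy⟩
      · right; exact ⟨hv1, hv2, h⟩
  rw [RB]
  intro w hw
  obtain ⟨c, hc, h⟩ := main w hw
  exact ⟨c, hc, h⟩

def QE {Y : Type} (r : Y → Y → Prop) (A : Set Y) (a : Ordinal.{0}) : Prop :=
  ∃ f : Ordinal.{0} → Y, (∀ x < a, f x ∈ A) ∧ ∀ x < a, ∀ y < a, r (f x) (f y) → x ≤ y

theorem QE_le {Y : Type} {r : Y → Y → Prop} :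
    ∀ (b a : Ordinal.{0}) (A : Set Y), QE r A a → RB r A b → a ≤ b := by
  intro b
  induction b using WellFoundedLT.induction with
  | ind b ih =>
  rintro a A ⟨f, h1, h2⟩ hR
  by_contra hlt
  rw [not_le] at hlt
  rw [RB] at hR
  obtain ⟨c, hc, hR'⟩ := hR (f b) (h1 b hlt)
  refine absurd hc (not_lt.2 (ih c hc b _ ⟨f, ?_, ?_⟩ hR'))
  · intro x hx
    refine ⟨h1 x (hx.trans hlt), fun h => ?_⟩
    exact absurd hx (not_lt.2 (h2 b hlt x (hx.trans hlt) h))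
  · intro x hx y hy
    exact h2 x (hx.trans hlt) y (hy.trans hlt)

theorem exists_last (a : Ordinal.{0}) : a ≠ 0 →
    ∃ d q : Ordinal.{0}, a = Ordinal.omega0 ^ d * q + Ordinal.omega0 ^ d := by
  induction a using WellFoundedLT.induction with
  | ind a ih =>
  intro h
  have h1 := Ordinal.opow_log_le_self Ordinal.omega0 h
  have h2 := Ordinal.lt_opow_succ_log_self Ordinal.one_lt_omega0 a
  have h4 := Ordinal.add_sub_cancel_of_le h1
  have h5 : a - Ordinal.omega0 ^ Ordinal.log Ordinal.omega0 a < a := by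
    refine lt_of_le_of_ne (Ordinal.sub_le_self _ _) fun heq => ?_
    rw [heq] at h4
    rw [Ordinal.add_eq_right_iff_mul_omega0_le, ← Ordinal.opow_succ] at h4
    exact absurd h2 (not_lt.2 h4)
  by_cases hc : a - Ordinal.omega0 ^ Ordinal.log Ordinal.omega0 a = 0
  · refine ⟨Ordinal.log Ordinal.omega0 a, 0, ?_⟩
    rw [hc, add_zero] at h4
    rw [mul_zero, zero_add, h4]
  · obtain ⟨d, q, hdq⟩ := ih _ h5 hc
    have hda : Ordinal.omega0 ^ d < a := by
      refine lt_of_le_of_lt ?_ h5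
      rw [hdq]; exact le_add_self
    have hd : d ≤ Ordinal.log Ordinal.omega0 a := by
      have := (Ordinal.opow_lt_opow_iff_right Ordinal.one_lt_omega0).1 (hda.trans h2)
      exact Order.lt_succ_iff.1 this
    refine ⟨d, Ordinal.omega0 ^ (Ordinal.log Ordinal.omega0 a - d) + q, ?_⟩
    rw [mul_add, ← Ordinal.opow_add, Ordinal.add_sub_cancel_of_le hd, add_assoc, ← hdq, h4]

theorem QE_of_LB {Y : Type} [Nonempty Y] [Countable Y] {r : Y → Y → Prop}
    (tr : ∀ a b c, r a b → r b c → r a c) (o : Ordinal.{0}) :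
    ∀ (a : Ordinal.{0}) (A : Set Y), RB r A o → LB r A a → QE r A a := by
  classical
  intro a
  induction a using WellFoundedLT.induction with
  | ind a ih =>
  intro A hAo hLB
  by_cases ha0 : a = 0
  · subst ha0
    obtain ⟨y⟩ := ‹Nonempty Y›
    exact ⟨fun _ => y, fun x hx => absurd hx not_lt_bot, fun x hx => absurd hx not_lt_bot⟩
  -- decomposition a = w * q + w  or indecomposable
  by_cases hsucc : ∃ b, a = b + 1
  · obtain ⟨b, rfl⟩ := hsucc
    have hb : b < b + 1 := lt_add_one b
    have h := hLB b hb
    rw [RB] at h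
    push Not at h
    obtain ⟨x, hx, hx'⟩ := h
    obtain ⟨f, h1, h2⟩ := ih b hb {y | y ∈ A ∧ ¬ r x y} (RB_sub hAo fun y hy => hy.1)
      (fun c hc => hx' c hc)
    refine ⟨fun z => if z < b then f z else x, ?_, ?_⟩
    · intro z _
      by_cases hz : z < b
      · simp only [hz, if_true]; exact (h1 z hz).1
      · simp only [hz, if_false]; exact hx
    · intro y hy z hz
      rw [Order.lt_add_one_iff] at hy hz
      by_cases hz' : z < b
      · by_cases hy' : y < b
        · simp only [hz', hy', if_true]; exact h2 y hy' z hz'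
        · simp only [hz', hy', if_true, if_false]
          exact fun h => absurd h (h1 z hz').2
      · intro _
        exact hy.trans (not_lt.1 hz')
  by_cases hdec : ∃ d q : Ordinal.{0}, q ≠ 0 ∧ a = Ordinal.omega0 ^ d * q + Ordinal.omega0 ^ d ∧
      Ordinal.omega0 ^ d < a ∧ Ordinal.omega0 ^ d * q < a
  · obtain ⟨d, q, -, hae, hda, hqa⟩ := hdec
    obtain ⟨D, hDA, hdc, hD1, hD2⟩ := exists_down tr o A (Ordinal.omega0 ^ d * q) hAo
      (fun c hc => hLB c (hc.trans hqa))
    have hE : LB r (A \ D) (Ordinal.omega0 ^ d) := by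
      intro ρ hρ hR
      have hU := RB_union _ _ _ _ hD1 hR
      rw [Set.union_sdiff_cancel hDA] at hU
      refine hLB _ ?_ hU
      have hpos : 0 < Ordinal.omega0 ^ d := Ordinal.opow_pos _ Ordinal.omega0_pos
      have := nad_split (nad_principal d) hpos.ne' q 0 0 ρ hpos hρ
      rw [mul_zero, zero_add, add_zero] at this
      rw [hae]
      refine this.trans_lt ?_
      refine lt_of_le_of_lt (add_le_add (mul_le_mul_right (nad_zero_le q) _) (zero_nad_le ρ)) ?_
      gcongr
    obtain ⟨f, f1, f2⟩ := ih _ hqa D (RB_sub hAo hDA) hD2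
    obtain ⟨g, g1, g2⟩ := ih _ hda (A \ D) (RB_sub hAo Set.sdiff_subset) hE
    set β := Ordinal.omega0 ^ d * q
    have hsub : ∀ x < a, ¬ x < β → x - β < Ordinal.omega0 ^ d := by
      intro x hx hxb
      have := Ordinal.add_sub_cancel_of_le (not_lt.1 hxb)
      rw [hae, ← this] at hx
      exact lt_of_add_lt_add_left hx
    refine ⟨fun x => if x < β then f x else g (x - β), ?_, ?_⟩
    · intro x hx
      by_cases hxb : x < β
      · simp only [hxb, if_true]; exact hDA (f1 x hxb)
      · simp only [hxb, if_false]; exact (g1 _ (hsub x hx hxb)).1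
    · intro x hx y hy
      by_cases hxb : x < β <;> by_cases hyb : y < β <;> simp only [hxb, hyb, if_true, if_false]
      · exact f2 x hxb y hyb
      · exact fun _ => hxb.le.trans (not_lt.1 hyb)
      · intro h
        have := g1 _ (hsub x hx hxb)
        exact absurd (hdc _ this.1 _ (f1 y hyb) h) this.2
      · intro h
        have := g2 _ (hsub x hx hxb) _ (hsub y hy hyb) h
        rw [← Ordinal.add_sub_cancel_of_le (not_lt.1 hxb),
          ← Ordinal.add_sub_cancel_of_le (not_lt.1 hyb)]
        gcongr
  -- indecomposable case
  have hpr : ∀ x < a, ∀ y < a, nad x y < a := by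
    obtain ⟨d, q, h⟩ := exists_last a ha0
    have hpos : 0 < Ordinal.omega0 ^ d := Ordinal.opow_pos _ Ordinal.omega0_pos
    by_cases hq : q = 0
    · subst hq
      rw [mul_zero, zero_add] at h
      rw [h]
      exact nad_principal d
    · exfalso
      have h1 : Ordinal.omega0 ^ d * q < a := by
        rw [h]; exact lt_add_of_pos_right _ hpos
      refine hdec ⟨d, q, hq, h, lt_of_le_of_lt ?_ h1, h1⟩
      exact le_mul_of_one_le_right bot_le (Order.one_le_iff_pos.2 (pos_iff_ne_zero.2 hq))
  have hlim : ∀ x < a, x + 1 < a := by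
    intro x hx
    refine lt_of_le_of_ne (Order.add_one_le_of_lt hx) fun h => hsucc ⟨x, h.symm⟩
  obtain ⟨A', hA'A, -, hA1, hA2⟩ := exists_down tr o A a hAo hLB
  obtain ⟨e, he⟩ := exists_surjective_nat Y
  have hal : ∀ n : ℕ, ∃ t < a, e n ∈ A' → LB r {y | y ∈ A' ∧ ¬ r (e n) y} t ∧
      RB r {y | y ∈ A' ∧ ¬ r (e n) y} t := by
    intro n
    by_cases hn : e n ∈ A'
    · have h := hA1
      rw [RB] at h
      obtain ⟨c, hc, hR⟩ := h _ hn
      obtain ⟨b, hb, h1, h2⟩ := exists_exact hR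
      exact ⟨b, hb.trans_lt hc, fun _ => ⟨h2, h1⟩⟩
    · exact ⟨0, pos_iff_ne_zero.2 ha0, fun h => absurd h hn⟩
  choose t ht hte using hal
  have hcof : ∀ x < a, ∃ n, x < t n + 1 := by
    intro x hx
    have h := hA2 x hx
    rw [RB] at h
    push Not at h
    obtain ⟨z, hz, hz'⟩ := h
    obtain ⟨n, rfl⟩ := he z
    refine ⟨n, ?_⟩
    rw [Order.lt_add_one_iff]
    by_contra hlt
    exact hz' _ (not_le.1 hlt) (hte n hz).2
  -- the step
  let S := {D : Set Y // D ⊆ A' ∧ (∀ x ∈ A', ∀ y ∈ D, r x y → x ∈ D) ∧ ∃ s < a, RB r D s}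
  have step : ∀ (n : ℕ) (D : S), ∃ D' : S, D.1 ⊆ D'.1 ∧ QE r (D'.1 \ D.1) (t n + 1) := by
    rintro n ⟨D, hD, hdc, s, hs, hsR⟩
    have hτ := hlim _ (ht n)
    have h := hA2 _ (hpr s hs _ hτ)
    have hA1' := hA1
    rw [RB] at h hA1'
    push Not at h
    obtain ⟨x, hx, hx'⟩ := h
    obtain ⟨c, hc, hcR⟩ := hA1' x hx
    have hU := RB_union _ _ _ _ hsR hcR
    refine ⟨⟨D ∪ {y | y ∈ A' ∧ ¬ r x y}, Set.union_subset hD (fun y hy => hy.1), ?_,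
      _, hpr s hs c hc, hU⟩, Set.subset_union_left, ?_⟩
    · rintro y hy z (hz | hz) hyz
      · left; exact hdc y hy z hz hyz
      · right; exact ⟨hy, fun h => hz.2 (tr _ _ _ h hyz)⟩
    · refine ih _ hτ _ ?_ ?_
      · refine RB_sub hAo (fun y hy => hA'A ?_)
        rcases hy.1 with h | h
        · exact hD h
        · exact h.1
      · intro ρ hρ hR
        have hU' := RB_union _ _ _ _ hsR hR
        refine hx' _ (nad_lt_right s hρ) (RB_sub hU' ?_)
        intro y hy
        by_cases hyD : y ∈ D
        · left; exact hyD
        · right; exact ⟨Or.inr hy, hyD⟩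
  choose nx hnx1 hnx2 using step
  let D0 : S := ⟨∅, Set.empty_subset _, by simp, 0, pos_iff_ne_zero.2 ha0, RB_empty⟩
  let Ds : ℕ → S := fun n => Nat.rec D0 (fun n D => nx n D) n
  have hDs : ∀ n, Ds (n + 1) = nx n (Ds n) := fun n => rfl
  have hmono : Monotone (fun n => (Ds n).1) := by
    refine monotone_nat_of_le_succ fun n => ?_
    show (Ds n).1 ⊆ (Ds (n + 1)).1
    rw [hDs]; exact hnx1 n _
  have hq : ∀ n, QE r ((Ds (n + 1)).1 \ (Ds n).1) (t n + 1) := by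
    intro n; rw [hDs]; exact hnx2 n _
  choose f f1 f2 using hq
  let N : Ordinal.{0} → ℕ := fun x => if h : ∃ n, x < t n + 1 then Nat.find h else 0
  have hN1 : ∀ x < a, x < t (N x) + 1 := by
    intro x hx
    have h := hcof x hx
    simp only [N, h, dif_pos]
    exact Nat.find_spec h
  have hN2 : ∀ x < a, ∀ m < N x, t m + 1 ≤ x := by
    intro x hx m hm
    have h := hcof x hx
    simp only [N, h, dif_pos] at hm
    exact not_lt.1 (Nat.find_min h hm)
  refine ⟨fun x => f (N x) x, ?_, ?_⟩
  · intro x hx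
    exact hA'A ((Ds (N x + 1)).2.1 (f1 (N x) x (hN1 x hx)).1)
  · intro x hx y hy hxy
    rcases lt_trichotomy (N x) (N y) with h | h | h
    · exact ((hN1 x hx).trans_le (hN2 y hy _ h)).le
    · have hy1 := hN1 y hy
      simp only [← h] at hxy hy1
      exact f2 (N x) x (hN1 x hx) y hy1 hxy
    · exfalso
      have hx1 := f1 (N x) x (hN1 x hx)
      have hy1 := f1 (N y) y (hN1 y hy)
      exact hx1.2 ((Ds (N x)).2.2.1 _ ((Ds (N x + 1)).2.1 hx1.1) _ (hmono (Nat.succ_le_of_lt h) hy1.1) hxy)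

theorem LTree.Le.tr {X : Type*} [PartialOrder X] : ∀ {a b c : LTree X},
    LTree.Le a b → LTree.Le b c → LTree.Le a c := by
  intro a b c h1 h2
  induction h2 generalizing a with
  | leaf h =>
    cases h1 with
    | leaf h' => exact .leaf (h'.trans h)
  | left _ ih => exact .left (ih h1)
  | right _ ih => exact .right (ih h1)
  | node hb _ _ ihl ihr =>
    cases h1 with
    | left h => exact .left (ihl h)
    | right h => exact .right (ihr h)
    | node hb' hl hr => exact .node (hb'.trans hb) (ihl hl) (ihr hr)

def LTree.dec {X : Type*} : LTree X → LTree X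
  | .leaf x => .leaf x
  | .node b l r => .node (b - 1) l.dec r.dec

theorem LTree.dec_innerLabels {X : Type*} (t : LTree X) :
    t.dec.innerLabels = t.innerLabels.map (· - 1) := by
  induction t with
  | leaf x => rfl
  | node b l r ihl ihr => simp [LTree.dec, LTree.innerLabels, ihl, ihr]

theorem LTree.dec_isBl {X : Type*} (t : LTree X) (h : t.IsBl) (hp : ∀ x ∈ t.innerLabels, 0 < x) :
    t.dec.IsBl := by
  induction t with
  | leaf x => trivial
  | node b l r ihl ihr =>
    obtain ⟨h1, h2, h3, h4⟩ := h
    simp only [LTree.innerLabels, List.mem_cons, List.mem_append] at hp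
    have hb := hp b (Or.inl rfl)
    refine ⟨?_, ?_, ihl h3 fun x hx => hp x (Or.inr (Or.inl hx)),
      ihr h4 fun x hx => hp x (Or.inr (Or.inr hx))⟩
    · rw [LTree.dec_innerLabels]
      intro x hx
      obtain ⟨y, hy, rfl⟩ := List.mem_map.1 hx
      have := h1 y hy
      show b - 1 < y - 1
      omega
    · rw [LTree.dec_innerLabels]
      intro x hx
      obtain ⟨y, hy, rfl⟩ := List.mem_map.1 hx
      have := h2 y hy
      show b - 1 ≤ y - 1
      omega

theorem LTree.dec_bounded {X : Type*} (n : ℕ) (t : LTree X) (h : t.BoundedBy (n + 1))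
    (hp : ∀ x ∈ t.innerLabels, 0 < x) : t.dec.BoundedBy n := by
  intro x hx
  rw [LTree.dec_innerLabels] at hx
  obtain ⟨y, hy, rfl⟩ := List.mem_map.1 hx
  have := h y hy
  have := hp y hy
  show y - 1 < n
  omega

theorem LTree.le_of_dec {X : Type*} [PartialOrder X] (s t : LTree X)
    (hp : ∀ x ∈ t.innerLabels, 0 < x) (h : LTree.Le s.dec t.dec) : LTree.Le s t := by
  induction t generalizing s with
  | leaf y =>
    cases s with
    | leaf x => exact h
    | node b l r => cases h
  | node c tl tr ihl ihr =>
    simp only [LTree.innerLabels, List.mem_cons, List.mem_append] at hp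
    have hc := hp c (Or.inl rfl)
    have hl := fun s => ihl s fun x hx => hp x (Or.inr (Or.inl hx))
    have hr := fun s => ihr s fun x hx => hp x (Or.inr (Or.inr hx))
    cases s with
    | leaf x =>
      cases h with
      | left h => exact .left (hl (.leaf x) h)
      | right h => exact .right (hr (.leaf x) h)
    | node b sl sr =>
      cases h with
      | left h => exact .left (hl (.node b sl sr) h)
      | right h => exact .right (hr (.node b sl sr) h)
      | node hb h1 h2 => exact .node (by omega) (hl _ h1) (hr _ h2)

def LTree.qe {X : Type*} : LTree X → List (LTree X)
  | .leaf x => [.leaf x]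
  | .node 0 l r => l.dec :: r.qe
  | .node (b + 1) l r => [LTree.dec (.node (b + 1) l r)]

theorem LTree.qe_ne_nil {X : Type*} (t : LTree X) : t.qe ≠ [] := by
  rcases t with x | ⟨_ | b, l, r⟩ <;> simp [LTree.qe]

theorem LTree.cases_qe {X : Type*} (t : LTree X) (h : t.IsBl) :
    (t.qe = [t.dec] ∧ ∀ x ∈ t.innerLabels, 0 < x) ∨ ∃ l r, t = .node 0 l r := by
  rcases t with x | ⟨_ | b, l, r⟩
  · left; exact ⟨rfl, fun x hx => by cases hx⟩
  · right; exact ⟨l, r, rfl⟩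
  · left
    refine ⟨rfl, ?_⟩
    obtain ⟨h1, h2, -, -⟩ := h
    intro x hx
    simp only [LTree.innerLabels, List.mem_cons, List.mem_append] at hx
    rcases hx with rfl | hx | hx
    · omega
    · have := h1 x hx; omega
    · have := h2 x hx; omega

theorem LTree.qe_spec {X : Type*} (n : ℕ) (t : LTree X) (h : t.IsBl) (hb : t.BoundedBy (n + 1)) :
    ∀ u ∈ t.qe, u.IsBl ∧ u.BoundedBy n := by
  induction t with
  | leaf x =>
    intro u hu
    simp only [LTree.qe, List.mem_singleton] at hu
    subst hu
    exact ⟨trivial, fun x hx => by cases hx⟩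
  | node b l r ihl ihr =>
    rcases LTree.cases_qe _ h with ⟨h1, h2⟩ | ⟨l', r', heq⟩
    · rw [h1]
      intro u hu
      rw [List.mem_singleton] at hu
      subst hu
      exact ⟨LTree.dec_isBl _ h h2, LTree.dec_bounded n _ hb h2⟩
    · injection heq with e1 e2 e3
      subst e1
      obtain ⟨h1, h2, h3, h4⟩ := h
      have hbl : l.BoundedBy (n + 1) := fun x hx => hb x (by simp [LTree.innerLabels, hx])
      have hbr : r.BoundedBy (n + 1) := fun x hx => hb x (by simp [LTree.innerLabels, hx])
      intro u hu
      rcases List.mem_cons.1 hu with rfl | hu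
      · exact ⟨LTree.dec_isBl _ h3 h1, LTree.dec_bounded n _ hbl h1⟩
      · exact ihr h4 hbr u hu

theorem LTree.le_of_qe {X : Type*} [PartialOrder X] (s t : LTree X) (hs : s.IsBl) (ht : t.IsBl)
    (h : List.SublistForall₂ LTree.Le s.qe t.qe) : LTree.Le s t := by
  have single : ∀ t s : LTree X, s.IsBl → (∀ x ∈ t.innerLabels, 0 < x) →
      List.SublistForall₂ LTree.Le s.qe [t.dec] → LTree.Le s t := by
    intro t s hs hp h
    rcases LTree.cases_qe s hs with ⟨e, -⟩ | ⟨l, r, rfl⟩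
    · rw [e] at h
      cases h with
      | cons h _ => exact LTree.le_of_dec _ _ hp h
      | cons_right h => cases h
    · exfalso
      have h : List.SublistForall₂ LTree.Le (l.dec :: r.qe) [t.dec] := h
      cases h with
      | cons _ h =>
        have := LTree.qe_ne_nil r
        generalize r.qe = q at h this
        cases h
        exact this rfl
      | cons_right h => cases h
  induction t generalizing s with
  | leaf x => exact single (.leaf x) s hs (fun x hx => by cases hx) h
  | node c tl tr ihl ihr =>
    rcases LTree.cases_qe _ ht with ⟨e, hp⟩ | ⟨l', r', heq⟩
    · rw [e] at h
      exact single _ s hs hp h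
    · injection heq with e1 e2 e3
      subst e1
      clear e2 e3
      obtain ⟨t1, t2, t3, t4⟩ := ht
      have h : List.SublistForall₂ LTree.Le s.qe (tl.dec :: tr.qe) := h
      rcases LTree.cases_qe s hs with ⟨e, -⟩ | ⟨l, r, rfl⟩
      · rw [e] at h
        cases h with
        | cons h _ => exact .left (LTree.le_of_dec _ _ t1 h)
        | cons_right h => rw [← e] at h; exact .right (ihr s hs t4 h)
      · have h : List.SublistForall₂ LTree.Le (l.dec :: r.qe) (tl.dec :: tr.qe) := h
        cases h with
        | cons h h' =>
          exact .node le_rfl (LTree.le_of_dec _ _ t1 h) (ihr r hs.2.2.2 t4 h')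
        | cons_right h => exact .right (ihr (.node 0 l r) hs t4 h)

def LTree.code : LTree Unit → ℕ
  | .leaf _ => 0
  | .node b l r => Nat.pair b (Nat.pair l.code r.code) + 1

theorem LTree.code_inj : Function.Injective LTree.code := by
  intro s
  induction s with
  | leaf x =>
    intro t h
    cases t with
    | leaf y => rfl
    | node c tl tr => simp [LTree.code] at h
  | node b l r ihl ihr =>
    intro t h
    cases t with
    | leaf y => simp [LTree.code] at h
    | node c tl tr =>
      simp only [LTree.code, Nat.add_right_cancel_iff, Nat.pair_eq_pair] at h
      obtain ⟨h1, h2, h3⟩ := h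
      rw [h1, ihl h2, ihr h3]

instance LTree.countable_unit : Countable (LTree Unit) := LTree.code_inj.countable

def BS (n : ℕ) : Set (LTree Unit) := {u | u.IsBl ∧ u.BoundedBy n}

theorem BS_step (n : ℕ) (a : Ordinal.{0}) (ga : Good a) (h : RB LTree.Le (BS n) a) :
    RB LTree.Le (BS (n + 1)) (Ordinal.omega0 ^ Ordinal.omega0 ^ a) := by
  refine RB_qe LTree.qe _ _ _ ?_ ?_ (RB_higman (r := LTree.Le) (fun _ _ _ => LTree.Le.tr) a (BS n) ga h)
  · intro t ht
    exact LTree.qe_spec n t ht.1 ht.2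
  · intro s hs t ht
    exact LTree.le_of_qe s t hs.1 ht.1

theorem BS_good (n : ℕ) : ∃ a, Good a ∧ RB LTree.Le (BS n) a := by
  induction n with
  | zero =>
    refine ⟨1, good_one, ?_⟩
    rw [RB]
    intro x hx
    refine ⟨0, zero_lt_one, RB_sub RB_empty ?_⟩
    have key : ∀ t ∈ BS 0, t = .leaf () := by
      rintro (⟨⟨⟩⟩ | ⟨b, l, r⟩) ht
      · rfl
      · exact absurd (ht.2 b (by simp [LTree.innerLabels])) (Nat.not_lt_zero _)
    rintro y ⟨hy, hxy⟩
    rw [key x hx, key y hy] at hxy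
    exact hxy (.leaf le_rfl)
  | succ n ih =>
    obtain ⟨a, ga, h⟩ := ih
    exact ⟨_, good_opow (good_opow ga), BS_step n a ga h⟩

theorem QE_of_mem (n : ℕ) (a : Ordinal.{0})
    (h : ∃ f : Set.Iio a → {u : LTree Unit // u.IsBl ∧ u.BoundedBy n},
      ∀ x y : Set.Iio a, LTree.Le (f x).1 (f y).1 → x ≤ y) : QE LTree.Le (BS n) a := by
  classical
  obtain ⟨f, hf⟩ := h
  refine ⟨fun x => if h : x < a then (f ⟨x, h⟩).1 else .leaf (), ?_, ?_⟩
  · intro x hx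
    simp only [hx, dif_pos]
    exact (f ⟨x, hx⟩).2
  · intro x hx y hy
    simp only [hx, hy, dif_pos]
    exact hf ⟨x, hx⟩ ⟨y, hy⟩

theorem mem_of_QE (n : ℕ) (a : Ordinal.{0}) (h : QE LTree.Le (BS n) a) :
    ∃ f : Set.Iio a → {u : LTree Unit // u.IsBl ∧ u.BoundedBy n},
      ∀ x y : Set.Iio a, LTree.Le (f x).1 (f y).1 → x ≤ y := by
  obtain ⟨f, h1, h2⟩ := h
  exact ⟨fun x => ⟨f x.1, h1 x.1 x.2⟩, fun x y hxy => h2 x.1 x.2 y.1 y.2 hxy⟩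

/-- For `n > 0` there is a quasi-embedding from `B^l_{n+1,X}` into finite
sequences over `B^l_{n,X}` with Higman's order; consequently
`o(B^l_{n+1,1}) ≤ ω ^ ω ^ o(B^l_{n,1})`. -/
theorem btreeL_quasiEmbeds_into_higman (n : ℕ) (hn : 0 < n) {X : Type*}
    [PartialOrder X] (hX : ∀ g : ℕ → X, ∃ i j : ℕ, i < j ∧ g i ≤ g j) :
    (∃ f : LTree X → List (LTree X),
      (∀ t : LTree X, t.IsBl → t.BoundedBy (n + 1) →
        ∀ u ∈ f t, u.IsBl ∧ u.BoundedBy n) ∧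
      (∀ s t : LTree X, s.IsBl → s.BoundedBy (n + 1) → t.IsBl →
        t.BoundedBy (n + 1) →
        List.SublistForall₂ LTree.Le (f s) (f t) → LTree.Le s t)) ∧
    motype (fun s t : {u : LTree Unit // u.IsBl ∧ u.BoundedBy (n + 1)} =>
        LTree.Le s.1 t.1) ≤
      Ordinal.omega0 ^ Ordinal.omega0 ^
        motype (fun s t : {u : LTree Unit // u.IsBl ∧ u.BoundedBy n} =>
          LTree.Le s.1 t.1) := by
  refine ⟨⟨LTree.qe, fun t h hb => LTree.qe_spec n t h hb,
    fun s t hs _ ht _ h => LTree.le_of_qe s t hs ht h⟩, ?_⟩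
  obtain ⟨a0, ga0, h0⟩ := BS_good n
  obtain ⟨a, ha, hR, hL⟩ := exists_exact h0
  have ga : Good a := fun b hb => ga0 b (hb.trans ha)
  have : Nonempty (LTree Unit) := ⟨.leaf ()⟩
  have hQ : QE LTree.Le (BS n) a := QE_of_LB (r := LTree.Le) (fun _ _ _ => LTree.Le.tr) a a (BS n) hR hL
  have hle : a ≤ motype (fun s t : {u : LTree Unit // u.IsBl ∧ u.BoundedBy n} =>
      LTree.Le s.1 t.1) := by
    refine le_csSup ⟨a, ?_⟩ (mem_of_QE n a hQ)
    intro b hb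
    exact QE_le a b _ (QE_of_mem n b hb) hR
  have hstep := BS_step n a ga hR
  refine csSup_le' ?_
  intro b hb
  refine (QE_le _ b _ (QE_of_mem (n + 1) b hb) hstep).trans ?_
  exact Ordinal.opow_le_opow_right Ordinal.omega0_pos
    (Ordinal.opow_le_opow_right Ordinal.omega0_pos hle)
end

section
/- There is no quasi-embedding from ω^* (finite sequences of natural numbers with Higman's embedding order) into S^w_2 (finite binary sequences ordered by the weak gap condition). -/
/-- The weak gap condition on finite sequences over a linear order. -/
def WeakGap {α : Type*} [LinearOrder α] (s t : List α) : Prop :=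
  ∃ f : Fin s.length → Fin t.length,
    StrictMono f ∧
    (∀ i, s.get i ≤ t.get (f i)) ∧
    ∀ (i : ℕ) (h : i + 1 < s.length) (j : Fin t.length),
      f ⟨i, Nat.lt_of_succ_lt h⟩ < j → j < f ⟨i + 1, h⟩ → s.get ⟨i + 1, h⟩ ≤ t.get j

/-- The strong gap condition on finite sequences over a linear order:
as the weak one, but additionally respecting the outer gap. -/
def StrongGap {α : Type*} [LinearOrder α] (s t : List α) : Prop :=
  ∃ f : Fin s.length → Fin t.length,
    StrictMono f ∧
    (∀ i, s.get i ≤ t.get (f i)) ∧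
    (∀ (i : ℕ) (h : i + 1 < s.length) (j : Fin t.length),
      f ⟨i, Nat.lt_of_succ_lt h⟩ < j → j < f ⟨i + 1, h⟩ → s.get ⟨i + 1, h⟩ ≤ t.get j) ∧
    ∀ (h : 0 < s.length) (j : Fin t.length), j < f ⟨0, h⟩ → s.get ⟨0, h⟩ ≤ t.get j

open Ordinal Order in
/-- natural (Hessenberg) sum -/
noncomputable def nadd' (a b : Ordinal.{0}) : Ordinal.{0} :=
  max (⨆ x : Set.Iio a, Order.succ (nadd' x.1 b)) (⨆ x : Set.Iio b, Order.succ (nadd' a x.1))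
termination_by (a, b)
decreasing_by
  · exact Prod.Lex.left _ _ x.2
  · exact Prod.Lex.right _ x.2

theorem nadd'_lt_left {a a' b : Ordinal.{0}} (h : a' < a) : nadd' a' b < nadd' a b := by
  rw [nadd'.eq_1 a b]
  apply lt_max_of_lt_left
  refine lt_of_lt_of_le (Order.lt_succ _) ?_
  exact Ordinal.le_iSup (fun x : Set.Iio a => Order.succ (nadd' x.1 b)) ⟨a', h⟩

theorem nadd'_lt_right {a b b' : Ordinal.{0}} (h : b' < b) : nadd' a b' < nadd' a b := by
  rw [nadd'.eq_1 a b]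
  apply lt_max_of_lt_right
  refine lt_of_lt_of_le (Order.lt_succ _) ?_
  exact Ordinal.le_iSup (fun x : Set.Iio b => Order.succ (nadd' a x.1)) ⟨b', h⟩

theorem nadd'_le {a b c : Ordinal.{0}} (h1 : ∀ a' < a, nadd' a' b < c)
    (h2 : ∀ b' < b, nadd' a b' < c) : nadd' a b ≤ c := by
  rw [nadd'.eq_1 a b]
  apply max_le
  · exact Ordinal.iSup_le (fun x => Order.succ_le_of_lt (h1 x.1 x.2))
  · exact Ordinal.iSup_le (fun x => Order.succ_le_of_lt (h2 x.1 x.2))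

theorem le_nadd'_left (a b : Ordinal.{0}) : a ≤ nadd' a b :=
  StrictMono.le_apply (f := fun a => nadd' a b) (fun _ _ h => nadd'_lt_left h)

open Ordinal in
theorem lt_block {W z x : Ordinal.{0}} {p : ℕ} (hx : x < W) (hz : z < W * p + x) :
    ∃ (p' : ℕ) (x' : Ordinal.{0}), z = W * p' + x' ∧ x' < W ∧ (p' < p ∨ (p' = p ∧ x' < x)) := by
  have hW : W ≠ 0 := by rintro rfl; simp at hx
  have hW' : 0 < W := pos_of_ne_zero hW
  have h1 : z / W ≤ p := by
    have : z / W < (p : Ordinal) + 1 := by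
      rw [Ordinal.div_lt hW, mul_add, mul_one]
      exact hz.trans (by gcongr)
    exact Order.lt_add_one_iff.mp this
  obtain ⟨p', hp'⟩ := Ordinal.lt_omega0.1 (h1.trans_lt (Ordinal.natCast_lt_omega0 p))
  have hzz : z = W * p' + z % W := by rw [← hp', Ordinal.div_add_mod]
  refine ⟨p', z % W, hzz, Ordinal.mod_lt _ hW, ?_⟩
  rw [hp'] at h1
  have h1' : p' ≤ p := by exact_mod_cast h1
  rcases h1'.lt_or_eq with h | h
  · exact Or.inl h
  · right
    refine ⟨h, ?_⟩
    rw [hzz, h] at hz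
    exact (add_lt_add_iff_left _).1 hz

open Ordinal in
theorem nadd'_block {W : Ordinal.{0}} (hW : ∀ x < W, ∀ y < W, nadd' x y < W) (X : Ordinal.{0}) :
    ∀ (Y : Ordinal.{0}) (p q : ℕ) (x y : Ordinal.{0}), x < W → y < W → X = W * p + x →
      Y = W * q + y → nadd' X Y ≤ W * ((p + q : ℕ) : Ordinal) + nadd' x y := by
  induction X using WellFoundedLT.induction with
  | ind X ihX =>
  intro Y
  induction Y using WellFoundedLT.induction with
  | ind Y ihY =>
  intro p q x y hx hy hX hY
  have aux : ∀ (n n' : ℕ) (u v : Ordinal.{0}), n' < n → u < W → W * (n' : Ordinal) + u < W * n + v := by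
    intro n n' u v hn hu
    calc W * (n' : Ordinal) + u < W * (n' : Ordinal) + W := by gcongr
      _ = W * ((n' + 1 : ℕ) : Ordinal) := by push_cast; rw [mul_add, mul_one]
      _ ≤ W * n := by
        gcongr
        omega
      _ ≤ _ := le_self_add
  apply nadd'_le
  · intro z hz
    obtain ⟨p', x', hz', hx', hc⟩ := lt_block hx (hX ▸ hz)
    refine (ihX z hz Y p' q x' y hx' hy hz' hY).trans_lt ?_
    rcases hc with h | ⟨rfl, h⟩
    · exact aux _ _ _ _ (by omega) (hW _ hx' _ hy)
    · gcongr
      exact nadd'_lt_left h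
  · intro z hz
    obtain ⟨q', y', hz', hy', hc⟩ := lt_block hy (hY ▸ hz)
    refine (ihY z hz p q' x y' hx hy' hX hz').trans_lt ?_
    rcases hc with h | ⟨rfl, h⟩
    · exact aux _ _ _ _ (by omega) (hW _ hx _ hy')
    · gcongr
      exact nadd'_lt_right h

open Ordinal in
theorem nadd'_lt_opow (c : Ordinal.{0}) : ∀ x < ω ^ c, ∀ y < ω ^ c, nadd' x y < ω ^ c := by
  induction c using WellFoundedLT.induction with
  | ind c ih =>
  intro x hx y hy
  rcases eq_or_ne c 0 with rfl | hc
  · simp only [opow_zero, Ordinal.lt_one_iff_zero] at hx hy ⊢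
    subst hx; subst hy
    have : nadd' 0 0 ≤ 0 := nadd'_le (fun a h => by simp at h) (fun a h => by simp at h)
    simpa using this
  · obtain ⟨c1, hc1, n1, h1⟩ := (lt_omega0_opow hc).1 hx
    obtain ⟨c2, hc2, n2, h2⟩ := (lt_omega0_opow hc).1 hy
    set d := max c1 c2 with hd
    have hdc : d < c := max_lt hc1 hc2
    have hpos : 0 < ω ^ d := opow_pos _ omega0_pos
    have h1' : x < ω ^ d * n1 + 0 := by
      rw [add_zero]
      refine h1.trans_le ?_
      exact mul_le_mul_left (opow_le_opow_right omega0_pos (le_max_left _ _)) _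
    have h2' : y < ω ^ d * n2 + 0 := by
      rw [add_zero]
      refine h2.trans_le ?_
      exact mul_le_mul_left (opow_le_opow_right omega0_pos (le_max_right _ _)) _
    obtain ⟨p, x', hx1, hx2, -⟩ := lt_block hpos h1'
    obtain ⟨q, y', hy1, hy2, -⟩ := lt_block hpos h2'
    refine (nadd'_block (ih d hdc) x y p q x' y' hx2 hy2 hx1 hy1).trans_lt ?_
    have h3 : ω ^ d * ((p + q : ℕ) : Ordinal) + nadd' x' y' < ω ^ d * ((p + q + 1 : ℕ) : Ordinal) := by
      rw [Nat.cast_succ (p+q), mul_add, mul_one]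
      gcongr
      exact ih d hdc _ hx2 _ hy2
    exact (lt_omega0_opow hc).2 ⟨d, hdc, _, h3⟩

/-! ### small sets -/

inductive TT {Y : Type} (r : Y → Y → Prop) : Ordinal.{0} → Set Y → Prop
  | step (a : Ordinal.{0}) (A : Set Y) (d : Y → Ordinal.{0}) (h1 : ∀ y ∈ A, d y < a)
      (h2 : ∀ y ∈ A, TT r (d y) {z | z ∈ A ∧ ¬ r y z}) : TT r a A
  | union (a : Ordinal.{0}) (A B : Set Y) : TT r a A → TT r a B → TT r a (A ∪ B)

inductive RR {Y : Type} (r : Y → Y → Prop) : Ordinal.{0} → Set Y → Prop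
  | step (a : Ordinal.{0}) (A : Set Y) (d : Y → Ordinal.{0}) (h1 : ∀ y ∈ A, d y < a)
      (h2 : ∀ y ∈ A, RR r (d y) {z | z ∈ A ∧ ¬ r y z}) : RR r a A

section
variable {Y Z : Type} {r : Y → Y → Prop} {r' : Z → Z → Prop}

theorem TT.mk' {a : Ordinal.{0}} {A : Set Y}
    (h : ∀ y ∈ A, ∃ a' < a, TT r a' {z | z ∈ A ∧ ¬ r y z}) : TT r a A := by
  classical
  choose! d hd using h
  exact TT.step a A d (fun y hy => (hd y hy).1) (fun y hy => (hd y hy).2)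

theorem RR.mk' {a : Ordinal.{0}} {A : Set Y}
    (h : ∀ y ∈ A, ∃ a' < a, RR r a' {z | z ∈ A ∧ ¬ r y z}) : RR r a A := by
  classical
  choose! d hd using h
  exact RR.step a A d (fun y hy => (hd y hy).1) (fun y hy => (hd y hy).2)

theorem TT.empty (a : Ordinal.{0}) : TT r a (∅ : Set Y) := TT.mk' (by simp)

theorem TT.mono {a b : Ordinal.{0}} {A : Set Y} (h : TT r a A) (hab : a ≤ b) : TT r b A := by
  induction h with
  | step a A d h1 h2 _ => exact TT.step _ _ d (fun y hy => (h1 y hy).trans_le hab) h2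
  | union a A B _ _ ih1 ih2 => exact TT.union _ _ _ (ih1 hab) (ih2 hab)

theorem TT.image {a : Ordinal.{0}} {B : Set Z} (h : TT r' a B) (ψ : Z → Y)
    (hψ : ∀ p ∈ B, ∀ q ∈ B, r' p q → r (ψ p) (ψ q)) :
    ∀ A : Set Y, A ⊆ ψ '' B → TT r a A := by
  induction h with
  | step a B d h1 h2 ih =>
    intro A hA
    apply TT.mk'
    intro y hy
    obtain ⟨p, hp, rfl⟩ := hA hy
    refine ⟨d p, h1 p hp, ih p hp (fun p hp q hq => hψ p hp.1 q hq.1) _ ?_⟩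
    rintro z ⟨hz, hz2⟩
    obtain ⟨q, hq, rfl⟩ := hA hz
    exact ⟨q, ⟨hq, fun h => hz2 (hψ _ hp _ hq h)⟩, rfl⟩
  | union a B C _ _ ih1 ih2 =>
    intro A hA
    have : A = (A ∩ ψ '' B) ∪ (A ∩ ψ '' C) := by
      rw [← Set.inter_union_distrib_left, ← Set.image_union]
      exact (Set.inter_eq_left.2 hA).symm
    rw [this]
    exact TT.union _ _ _
      (ih1 (fun p hp q hq => hψ p (Or.inl hp) q (Or.inl hq)) _ Set.inter_subset_right)
      (ih2 (fun p hp q hq => hψ p (Or.inr hp) q (Or.inr hq)) _ Set.inter_subset_right)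

theorem TT.subset {a : Ordinal.{0}} {A B : Set Y} (h : TT r a B) (hA : A ⊆ B) : TT r a A :=
  h.image id (fun _ _ _ _ h => h) A (by simpa using hA)

theorem TT.prod {a b : Ordinal.{0}} {A : Set Y} {B : Set Z} (hA : TT r a A) (hB : TT r' b B) :
    TT (fun p q : Y × Z => r p.1 q.1 ∧ r' p.2 q.2) (nadd' a b) (A ×ˢ B) := by
  induction hA generalizing b B with
  | step a A d h1 h2 ih =>
    induction hB with
    | step b B e g1 g2 jh =>
      apply TT.mk'
      rintro ⟨x, y⟩ ⟨hx, hy⟩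
      refine ⟨max (nadd' (d x) b) (nadd' a (e y)),
        max_lt (nadd'_lt_left (h1 x hx)) (nadd'_lt_right (g1 y hy)), ?_⟩
      have k1 := (ih x hx (TT.step b B e g1 g2)).mono (le_max_left _ (nadd' a (e y)))
      have k2 := (jh y hy).mono (le_max_right (nadd' (d x) b) _)
      refine (TT.union _ _ _ k1 k2).subset ?_
      rintro ⟨u, v⟩ ⟨⟨hu, hv⟩, h⟩
      simp only at hu hv h
      by_cases hr : r x u
      · right
        exact ⟨hu, hv, fun h' => h ⟨hr, h'⟩⟩
      · left
        exact ⟨⟨hu, hr⟩, hv⟩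
    | union b B C _ _ ih1 ih2 =>
      rw [Set.prod_union]
      exact TT.union _ _ _ ih1 ih2
  | union a A A' _ _ ih1 ih2 =>
    rw [Set.union_prod]
    exact TT.union _ _ _ (ih1 hB) (ih2 hB)

theorem RR.subset {a : Ordinal.{0}} {B : Set Y} (h : RR r a B) : ∀ A ⊆ B, RR r a A := by
  induction h with
  | step a B d h1 h2 ih =>
    intro A hA
    exact RR.step _ _ d (fun y hy => h1 y (hA hy))
      (fun y hy => ih y (hA hy) _ (fun z hz => ⟨hA hz.1, hz.2⟩))

theorem RR.union {a b : Ordinal.{0}} {A B : Set Y} (hA : RR r a A) (hB : RR r b B) :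
    RR r (nadd' a b) (A ∪ B) := by
  induction hA generalizing b B with
  | step a A d h1 h2 ih =>
    induction hB with
    | step b B e g1 g2 jh =>
      apply RR.mk'
      rintro y (hy | hy)
      · refine ⟨_, nadd'_lt_left (h1 y hy), (ih y hy (RR.step b B e g1 g2)).subset _ ?_⟩
        rintro z ⟨hz | hz, hz2⟩
        · exact Or.inl ⟨hz, hz2⟩
        · exact Or.inr hz
      · refine ⟨_, nadd'_lt_right (g1 y hy), (jh y hy).subset _ ?_⟩
        rintro z ⟨hz | hz, hz2⟩
        · exact Or.inl hz
        · exact Or.inr ⟨hz, hz2⟩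

open Ordinal in
theorem TT.toRR {a : Ordinal.{0}} {A : Set Y} (h : TT r a A) :
    ∃ c < ω ^ (a + 1), RR r c A := by
  induction h with
  | step a A d h1 h2 ih =>
    refine ⟨ω ^ a, (opow_lt_opow_iff_right one_lt_omega0).2 (Order.lt_add_one_iff.2 le_rfl), ?_⟩
    apply RR.mk'
    intro y hy
    obtain ⟨c, hc, hR⟩ := ih y hy
    refine ⟨c, hc.trans_le (opow_le_opow_right omega0_pos ?_), hR⟩
    exact Order.add_one_le_of_lt (h1 y hy)
  | union a A B _ _ ih1 ih2 =>
    obtain ⟨c, hc, h⟩ := ih1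
    obtain ⟨c', hc', h'⟩ := ih2
    exact ⟨_, nadd'_lt_opow _ _ hc _ hc', h.union h'⟩

theorem RR.no_embed {a : Ordinal.{0}} {A : Set Y} (h : RR r a A) (f : Ordinal.{0} → Y)
    (hf : ∀ b ≤ a, ∀ c < b, ¬ r (f b) (f c)) (hA : ∀ b ≤ a, f b ∈ A) : False := by
  induction h with
  | step a A d h1 h2 ih =>
    have ha := hA a le_rfl
    have hd := h1 _ ha
    refine ih (f a) ha (fun b hb => hf b (hb.trans hd.le)) (fun b hb => ⟨hA b (hb.trans hd.le), ?_⟩)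
    exact hf a le_rfl b (hb.trans_lt hd)

end

/-! ### binary words -/

inductive HH : List Bool → List Bool → Prop
  | nil (t) : HH [] t
  | cons {a b s t} : a ≤ b → HH s t → HH (a :: s) (b :: t)
  | skip {a b s t} : a ≤ b → HH (a :: s) t → HH (a :: s) (b :: t)

inductive Blk (m : ℕ) : List Bool → Prop
  | nil : Blk m []
  | cons {i : ℕ} {q : List Bool} : i < m → Blk m q → Blk m (false :: (List.replicate i true ++ q))

/-- starting with `false`, or empty -/
def ZZ (q : List Bool) : Prop := q = [] ∨ ∃ z, q = false :: z

theorem Blk.zz {m q} (h : Blk m q) : ZZ q := by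
  cases h with
  | nil => exact Or.inl rfl
  | cons _ _ => exact Or.inr ⟨_, rfl⟩

theorem HH.zskip {q t : List Bool} (hq : ZZ q) (h : HH q t) (p : List Bool) : HH q (p ++ t) := by
  rcases hq with rfl | ⟨z, rfl⟩
  · exact HH.nil _
  · induction p with
    | nil => exact h
    | cons b p ih => exact HH.skip (Bool.false_le b) ih

theorem HH.append {x x2 q t : List Bool} (hx : HH x x2) (hq : ZZ q) (h : HH q t) :
    HH (x ++ q) (x2 ++ t) := by
  induction hx with
  | nil t' => exact h.zskip hq t'
  | cons hab _ ih => exact HH.cons hab ih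
  | skip hab _ ih => exact HH.skip hab ih

theorem HH.ones {q t : List Bool} (hq : ZZ q) (h : HH q t) {i j : ℕ} (hij : i ≤ j) :
    HH (List.replicate i true ++ q) (List.replicate j true ++ t) := by
  induction i generalizing j with
  | zero => exact h.zskip hq _
  | succ i ih =>
    obtain ⟨j, rfl⟩ : ∃ k, j = k + 1 := ⟨j - 1, by omega⟩
    exact HH.cons le_rfl (ih (by omega))

theorem HH.into_ones (u : List Bool) {i : ℕ} (h : u.length ≤ i) (r : List Bool) :
    HH u (List.replicate i true ++ r) := by
  induction u generalizing i with
  | nil => exact HH.nil _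
  | cons a u ih =>
    obtain ⟨i, rfl⟩ : ∃ k, i = k + 1 := ⟨i - 1, by simp at h; omega⟩
    exact HH.cons (Bool.le_true a) (ih (by simpa using h))

theorem exists_blocks (q : List Bool) : ∃ i r, ZZ r ∧ q = List.replicate i true ++ r := by
  induction q with
  | nil => exact ⟨0, [], Or.inl rfl, rfl⟩
  | cons b q ih =>
    cases b with
    | false => exact ⟨0, _, Or.inr ⟨q, rfl⟩, rfl⟩
    | true =>
      obtain ⟨i, r, hr, rfl⟩ := ih
      exact ⟨i + 1, r, hr, rfl⟩

theorem blk_or_hh {u : List Bool} (hu : ZZ u) (n : ℕ) :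
    ∀ t : List Bool, t.length ≤ n → ZZ t → Blk (u.length + 1) t ∨ HH u t := by
  induction n with
  | zero =>
    intro t ht _
    obtain rfl : t = [] := by simpa using ht
    exact Or.inl Blk.nil
  | succ n ih =>
    rintro t ht (rfl | ⟨z, rfl⟩)
    · exact Or.inl Blk.nil
    obtain ⟨i, r, hr, rfl⟩ := exists_blocks z
    by_cases hi : i < u.length + 1
    · rcases ih r (by simp at ht; omega) hr with h | h
      · exact Or.inl (Blk.cons hi h)
      · right
        have := h.zskip hu (false :: List.replicate i true)
        simpa using this
    · right
      have := (HH.into_ones u (i := i) (by omega) r).zskip hu [false]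
      simpa using this

theorem Blk.decomp {m M : ℕ} {t : List Bool} (h : Blk M t) :
    Blk m t ∨ ∃ x j q, Blk m x ∧ m ≤ j ∧ j < M ∧ Blk M q ∧
      t = x ++ false :: (List.replicate j true ++ q) := by
  induction h with
  | nil => exact Or.inl Blk.nil
  | @cons i q hi hq ih =>
    by_cases him : i < m
    · rcases ih with h | ⟨x, j, q2, hx, h1, h2, h3, rfl⟩
      · exact Or.inl (Blk.cons him h)
      · exact Or.inr ⟨_, j, q2, Blk.cons him hx, h1, h2, h3, by simp⟩
    · exact Or.inr ⟨[], i, q, Blk.nil, by omega, hi, hq, rfl⟩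

/-- Iterated natural sum. -/
noncomputable def nmul' (a : Ordinal.{0}) : ℕ → Ordinal.{0}
  | 0 => 0
  | n + 1 => nadd' a (nmul' a n)

theorem TT.biUnion {Y : Type} {r : Y → Y → Prop} {a : Ordinal.{0}} (F : ℕ → Set Y)
    (h : ∀ j, TT r a (F j)) (M : ℕ) : TT r a {y | ∃ j < M, y ∈ F j} := by
  induction M with
  | zero => exact (TT.empty a).subset (by rintro y ⟨j, hj, -⟩; omega)
  | succ M ih =>
    refine (TT.union _ _ _ ih (h M)).subset ?_
    rintro y ⟨j, hj, hy⟩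
    rcases Nat.lt_succ_iff_lt_or_eq.1 hj with h | rfl
    · exact Or.inl ⟨j, h, hy⟩
    · exact Or.inr hy

theorem residual_small {m : ℕ} {a : Ordinal.{0}} (ha : TT HH a {q | Blk m q}) (M : ℕ)
    {w : List Bool} (hw : Blk (m + 1) w) :
    ∃ c, TT HH (nmul' a c) {t | Blk M t ∧ ¬ HH w t} := by
  induction hw with
  | nil => exact ⟨0, (TT.empty _).subset (fun t ht => ht.2 (HH.nil _))⟩
  | @cons i w hi hw ih =>
    obtain ⟨c, hc⟩ := ih
    refine ⟨c + 1, ?_⟩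
    have hp := ha.prod hc
    have key := TT.biUnion (r := HH) (a := nadd' a (nmul' a c))
      (fun j => {t | m ≤ j ∧ ∃ x q, Blk m x ∧ (Blk M q ∧ ¬ HH w q) ∧
        t = x ++ false :: (List.replicate j true ++ q)}) (by
        intro j
        refine hp.image (fun p => p.1 ++ false :: (List.replicate j true ++ p.2)) ?_ _ ?_
        · rintro ⟨x, q⟩ ⟨-, hq⟩ ⟨x2, q2⟩ - ⟨h1, h2⟩
          exact HH.append h1 (Or.inr ⟨_, rfl⟩) (HH.cons le_rfl (HH.ones hq.1.zz h2 le_rfl))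
        · rintro t ⟨-, x, q, hx, hq, rfl⟩
          exact ⟨(x, q), ⟨hx, hq⟩, rfl⟩) M
    refine (TT.union _ _ _ (ha.mono (le_nadd'_left a (nmul' a c))) key).subset ?_
    rintro t ⟨ht, hwt⟩
    rcases ht.decomp (m := m) with h | ⟨x, j, q, hx, h1, h2, h3, rfl⟩
    · exact Or.inl h
    · refine Or.inr ⟨j, h2, h1, x, q, hx, ⟨h3, fun h => hwt ?_⟩, rfl⟩
      exact HH.zskip (Or.inr ⟨_, rfl⟩) (HH.cons le_rfl (HH.ones hw.zz h (by omega))) x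

open Ordinal in
theorem nmul'_lt (m c : ℕ) : nmul' (ω ^ (m : Ordinal.{0})) c < ω ^ ((m + 1 : ℕ) : Ordinal.{0}) := by
  induction c with
  | zero => exact opow_pos _ omega0_pos
  | succ c ih =>
    refine nadd'_lt_opow _ _ ?_ _ ih
    exact (opow_lt_opow_iff_right one_lt_omega0).2 (by exact_mod_cast Nat.lt_succ_self m)

open Ordinal in
theorem blk_small (m : ℕ) : TT HH (ω ^ (m : Ordinal.{0})) {q | Blk m q} := by
  induction m with
  | zero =>
    apply TT.mk'
    intro y hy
    refine ⟨0, by simp, (TT.empty _).subset ?_⟩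
    rintro z ⟨-, hz⟩
    cases hy with
    | nil => exact hz (HH.nil _)
    | cons h _ => omega
  | succ m ih =>
    apply TT.mk'
    intro y hy
    obtain ⟨c, hc⟩ := residual_small ih (m + 1) hy
    exact ⟨_, nmul'_lt m c, hc⟩

/-! ### from `HH` to `WeakGap` -/

theorem HH.fn {s t : List Bool} (h : HH s t) : ∃ f : ℕ → ℕ,
    (∀ i < s.length, f i < t.length ∧ s.getD i false ≤ t.getD (f i) false) ∧
    (∀ i, i + 1 < s.length → f i < f (i + 1)) ∧
    (∀ i j, i + 1 < s.length → f i < j → j < f (i + 1) →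
      s.getD (i + 1) false ≤ t.getD j false) ∧
    (∀ j, 0 < s.length → j < f 0 → s.getD 0 false ≤ t.getD j false) := by
  induction h with
  | nil t => exact ⟨id, by simp⟩
  | @cons a b s t hab _ ih =>
    obtain ⟨f, h1, h2, h3, h4⟩ := ih
    refine ⟨fun i => match i with | 0 => 0 | i + 1 => f i + 1, ?_, ?_, ?_, ?_⟩
    · rintro (_ | i) hi
      · simpa using hab
      · have := h1 i (by simpa using hi)
        simpa using this
    · rintro (_ | i) hi
      · simp
      · have := h2 i (by simpa using hi)
        simpa using this
    · rintro (_ | i) (_ | j) hi hj hj'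
      · simp at hj
      · have := h4 j (by simpa using hi) (by simpa using hj')
        simpa using this
      · simp at hj
      · have := h3 i j (by simpa using hi) (by simpa using hj) (by simpa using hj')
        simpa using this
    · intro j _ hj
      simp at hj
  | @skip a b s t hab _ ih =>
    obtain ⟨f, h1, h2, h3, h4⟩ := ih
    refine ⟨fun i => f i + 1, ?_, ?_, ?_, ?_⟩
    · intro i hi
      have := h1 i hi
      simpa using this
    · intro i hi
      have := h2 i hi
      simpa using this
    · rintro i (_ | j) hi hj hj'
      · simp at hj
      · have := h3 i j hi (by simpa using hj) (by simpa using hj')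
        simpa using this
    · rintro (_ | j) hi hj
      · simpa using hab
      · have := h4 j hi (by simpa using hj)
        simpa using this

theorem HH.weakGap_tail {s t : List Bool} (h : HH (false :: s) (false :: t)) : WeakGap s t := by
  obtain ⟨f, h1, h2, h3, -⟩ := h.fn
  have hmono : ∀ i j, i < j → j < s.length + 1 → f i < f j := by
    intro i j hij
    induction j, hij using Nat.le_induction with
    | base => intro hj; exact h2 i (by simpa using hj)
    | succ j hij ih =>
      intro hj
      exact (ih (by omega)).trans (h2 j (by simpa using hj))
  have hpos : ∀ i < s.length, 0 < f (i + 1) := fun i hi =>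
    (Nat.zero_le _).trans_lt (hmono 0 (i + 1) (by omega) (by omega))
  have hlt : ∀ i < s.length, f (i + 1) - 1 < t.length := fun i hi => by
    have h5 := (h1 (i + 1) (by simpa using hi)).1
    have h6 := hpos i hi
    simp at h5
    omega
  have conv : ∀ (l : List Bool) (i : ℕ) (hi : i < l.length), l[i] = l.getD i false := by
    intro l i hi
    simp [hi]
  refine ⟨fun i => ⟨f (i + 1) - 1, hlt i i.2⟩, ?_, ?_, ?_⟩
  · intro i j hij
    have h5 := hmono (i + 1) (j + 1) (by simpa using hij) (by simp)
    have h6 := hpos i i.2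
    simp only [Fin.mk_lt_mk]
    omega
  · intro i
    have h5 := (h1 (i + 1) (by simp)).2
    have h6 := hpos i i.2
    obtain ⟨k, hk⟩ : ∃ k, f (i + 1) = k + 1 := ⟨f (i + 1) - 1, by omega⟩
    simp only [List.get_eq_getElem, conv, hk, Nat.add_sub_cancel]
    rw [hk] at h5
    simpa only [List.getD_cons_succ] using h5
  · intro i hi j hj hj'
    have h6 := hpos i (by omega)
    have h7 := hpos (i + 1) hi
    have hj1 : f (i + 1) - 1 < j.1 := hj
    have hj2 : j.1 < f (i + 1 + 1) - 1 := hj'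
    have h5 := h3 (i + 1) (j + 1) (by simpa using hi) (by omega) (by omega)
    simp only [List.get_eq_getElem, conv]
    simpa only [List.getD_cons_succ] using h5

/-! ### lower bound -/

abbrev Hig (s t : List ℕ) : Prop := List.SublistForall₂ (· ≤ ·) s t

theorem Hig.length {s t : List ℕ} (h : Hig s t) : s.length ≤ t.length := by
  induction h with
  | nil => simp
  | cons _ _ ih => simpa using ih
  | cons_right _ ih => simp; omega

theorem Hig.count {N : ℕ} {s t : List ℕ} (h : Hig s t) (ht : ∀ x ∈ t, x ≤ N) :
    s.count N ≤ t.count N := by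
  induction h with
  | nil => simp
  | @cons a b s t hab _ ih =>
    have h1 := ih (fun x hx => ht x (by simp [hx]))
    have h2 := ht b (by simp)
    simp only [List.count_cons, beq_iff_eq]
    split_ifs <;> omega
  | @cons_right a s t _ ih =>
    have h1 := ih (fun x hx => ht x (by simp [hx]))
    simp only [List.count_cons]
    omega

theorem Hig.split {p r t : List ℕ} (h : Hig (p ++ r) t) :
    ∃ t1 t2, t = t1 ++ t2 ∧ Hig p t1 ∧ Hig r t2 := by
  generalize hs : p ++ r = s at h
  induction h generalizing p with
  | nil =>
    obtain ⟨rfl, rfl⟩ := List.append_eq_nil_iff.1 hs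
    exact ⟨[], _, rfl, .nil, .nil⟩
  | @cons a b s t hab hst ih =>
    cases p with
    | nil =>
      simp only [List.nil_append] at hs
      subst hs
      exact ⟨[], b :: t, rfl, .nil, .cons hab hst⟩
    | cons x p =>
      simp only [List.cons_append, List.cons.injEq] at hs
      obtain ⟨rfl, hs⟩ := hs
      obtain ⟨t1, t2, rfl, h1, h2⟩ := ih hs
      exact ⟨b :: t1, t2, rfl, .cons hab h1, h2⟩
  | @cons_right b s t hst ih =>
    obtain ⟨t1, t2, rfl, h1, h2⟩ := ih hs
    exact ⟨b :: t1, t2, rfl, .cons_right h1, h2⟩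

theorem Hig.append_right {p t : List ℕ} (h : Hig p t) (a : List ℕ) : Hig p (t ++ a) := by
  induction h with
  | nil => exact .nil
  | cons hab _ ih => exact .cons hab ih
  | cons_right _ ih => exact .cons_right ih

theorem Hig.top_false {N : ℕ} {u t : List ℕ} (h : Hig (N :: u) t) (ht : ∀ x ∈ t, x < N) : False := by
  generalize hs : N :: u = s at h
  induction h with
  | nil => simp at hs
  | @cons a b s t hab _ _ =>
    have := ht b (by simp)
    simp only [List.cons.injEq] at hs
    omega
  | cons_right _ ih => exact ih (fun x hx => ht x (by simp [hx])) hs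

theorem Hig.top_cancel {N : ℕ} {u v a : List ℕ} (ha : ∀ x ∈ a, x < N) (hv : ∀ x ∈ v, x < N)
    (h : Hig (N :: u) (a ++ N :: v)) : Hig u v := by
  induction a with
  | nil =>
    cases h with
    | cons _ h => exact h
    | cons_right h => exact (Hig.top_false h hv).elim
  | cons b a ih =>
    cases h with
    | cons h1 _ =>
      have := ha b (by simp)
      omega
    | cons_right h => exact ih (fun x hx => ha x (by simp [hx])) h

theorem Hig.cancel {N : ℕ} {p q u v : List ℕ} (hq : ∀ x ∈ q, x ≤ N)
    (hv : ∀ x ∈ v, x < N) (hc : q.count N ≤ p.count N)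
    (h : Hig (p ++ N :: u) (q ++ N :: v)) : Hig p q ∧ Hig u v := by
  obtain ⟨t1, t2, ht, h1, h2⟩ := h.split
  rcases List.append_eq_append_iff.1 ht with ⟨a, rfl, h3⟩ | ⟨a, rfl, rfl⟩
  · cases a with
    | nil =>
      simp only [List.nil_append] at h3
      subst h3
      exact ⟨by simpa using h1, h2.top_cancel (a := []) (by simp) hv⟩
    | cons b a =>
      simp only [List.cons_append, List.cons.injEq] at h3
      obtain ⟨-, rfl⟩ := h3
      exact (h2.top_false (fun x hx => hv x (by simp [hx]))).elim
  · refine ⟨h1.append_right a, h2.top_cancel (fun x hx => ?_) hv⟩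
    have h4 := h1.count (N := N) (fun x hx => hq x (by simp [hx]))
    rw [List.count_append] at hc
    have h5 : a.count N = 0 := by omega
    have h6 := hq x (by simp [hx])
    rcases h6.lt_or_eq with h7 | rfl
    · exact h7
    · exact absurd hx (List.count_eq_zero.1 h5)

noncomputable def digits' (N : ℕ) (α : Ordinal.{0}) (f : Ordinal.{0} → List ℕ) :
    ℕ → Ordinal.{0} → List ℕ
  | 0, b => f b
  | k + 1, b => digits' N α f k (b / α) ++ N :: f (b % α)

section
variable {N : ℕ} {α : Ordinal.{0}} {f : Ordinal.{0} → List ℕ}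
  (hα : α ≠ 0) (hN : ∀ b < α, ∀ x ∈ f b, x < N)
  (hf : ∀ b < α, ∀ c < α, Hig (f b) (f c) → b ≤ c)

include hα hN in
theorem digits'_le (k : ℕ) : ∀ b < α ^ (k + 1), ∀ x ∈ digits' N α f k b, x ≤ N := by
  induction k with
  | zero =>
    intro b hb x hx
    exact (hN b (by simpa using hb) x hx).le
  | succ k ih =>
    intro b hb x hx
    rw [digits', List.mem_append, List.mem_cons] at hx
    rcases hx with hx | rfl | hx
    · refine ih (b / α) ?_ x hx
      rw [Ordinal.div_lt hα, ← pow_succ']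
      exact hb
    · exact le_rfl
    · exact (hN _ (Ordinal.mod_lt _ hα) x hx).le

include hα hN in
theorem digits'_count (k : ℕ) : ∀ b < α ^ (k + 1), (digits' N α f k b).count N = k := by
  have h0 : ∀ b < α, (f b).count N = 0 := by
    intro b hb
    exact List.count_eq_zero.2 (fun h => (hN b hb _ h).false)
  induction k with
  | zero =>
    intro b hb
    exact h0 b (by simpa using hb)
  | succ k ih =>
    intro b hb
    rw [digits', List.count_append, List.count_cons, h0 _ (Ordinal.mod_lt _ hα), ih]
    · simp
    · rw [Ordinal.div_lt hα, ← pow_succ']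
      exact hb

include hα hN hf in
theorem digits'_refl (k : ℕ) : ∀ b < α ^ (k + 1), ∀ c < α ^ (k + 1),
    Hig (digits' N α f k b) (digits' N α f k c) → b ≤ c := by
  induction k with
  | zero =>
    intro b hb c hc h
    exact hf b (by simpa using hb) c (by simpa using hc) h
  | succ k ih =>
    intro b hb c hc h
    have hb' : b / α < α ^ (k + 1) := by
      rw [Ordinal.div_lt hα, ← pow_succ']
      exact hb
    have hc' : c / α < α ^ (k + 1) := by
      rw [Ordinal.div_lt hα, ← pow_succ']
      exact hc
    obtain ⟨h1, h2⟩ := Hig.cancel (digits'_le hα hN k _ hc') (hN _ (Ordinal.mod_lt _ hα))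
      (by rw [digits'_count hα hN k _ hc', digits'_count hα hN k _ hb']) h
    have h3 := ih _ hb' _ hc' h1
    have h4 := hf _ (Ordinal.mod_lt _ hα) _ (Ordinal.mod_lt _ hα) h2
    rw [← Ordinal.div_add_mod b α, ← Ordinal.div_add_mod c α]
    gcongr

end

open Ordinal in
theorem lower (N : ℕ) : ∃ f : Ordinal.{0} → List ℕ,
    (∀ b < ω ^ (ω ^ (N : Ordinal.{0})), ∀ x ∈ f b, x < N + 1) ∧
    (∀ b < ω ^ (ω ^ (N : Ordinal.{0})), ∀ c < ω ^ (ω ^ (N : Ordinal.{0})),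
      Hig (f b) (f c) → b ≤ c) := by
  induction N with
  | zero =>
    have : ∀ b : Ordinal.{0}, ∃ n : ℕ, b < ω → b = n := by
      intro b
      by_cases h : b < ω
      · obtain ⟨n, hn⟩ := lt_omega0.1 h
        exact ⟨n, fun _ => hn⟩
      · exact ⟨0, fun h' => absurd h' h⟩
    choose g hg using this
    refine ⟨fun b => List.replicate (g b) 0, ?_, ?_⟩
    · intro b _ x hx
      rw [List.eq_of_mem_replicate hx]
      omega
    · intro b hb c hc h
      simp only [Nat.cast_zero, opow_zero, opow_one] at hb hc
      rw [hg b hb, hg c hc]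
      have := h.length
      simp only [List.length_replicate] at this
      exact_mod_cast this
  | succ N ih =>
    obtain ⟨f, hN, hf⟩ := ih
    set α := ω ^ (ω ^ (N : Ordinal.{0})) with hαd
    have hα : α ≠ 0 := (opow_pos _ omega0_pos).ne'
    have hα1 : 1 ≤ α := Ordinal.one_le_iff_ne_zero.2 hα
    have hpow : ω ^ (ω ^ ((N + 1 : ℕ) : Ordinal.{0})) = α ^ ω := by
      rw [hαd, ← opow_mul]
      congr 1
      push_cast
      rw [opow_add, opow_one]
    rw [hpow]
    have hex : ∀ b : Ordinal.{0}, b < α ^ ω → ∃ k : ℕ, b < α ^ (k + 1) := by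
      intro b hb
      obtain ⟨d, hd, h⟩ := (lt_opow_of_isSuccLimit hα isSuccLimit_omega0).1 hb
      obtain ⟨n, rfl⟩ := lt_omega0.1 hd
      refine ⟨n, ?_⟩
      rw [opow_natCast] at h
      refine h.trans_le ?_
      rw [← opow_natCast, ← opow_natCast]
      exact opow_le_opow_right (pos_of_ne_zero hα) (by exact_mod_cast Nat.le_succ n)
    classical
    have hk : ∀ b : Ordinal.{0}, ∃ k : ℕ, b < α ^ ω →
        b < α ^ (k + 1) ∧ ∀ k' < k, ¬ b < α ^ (k' + 1) := by
      intro b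
      by_cases hb : b < α ^ ω
      · exact ⟨Nat.find (hex b hb), fun _ => ⟨Nat.find_spec (hex b hb),
          fun k' h => Nat.find_min (hex b hb) h⟩⟩
      · exact ⟨0, fun h => absurd h hb⟩
    choose k hk using hk
    refine ⟨fun b => digits' (N + 1) α f (k b) b, ?_, ?_⟩
    · intro b hb x hx
      exact Nat.lt_succ_of_le (digits'_le hα hN _ b (hk b hb).1 x hx)
    · intro b hb c hc h
      have h1 := h.count (N := N + 1) (digits'_le hα hN _ c (hk c hc).1)
      rw [digits'_count hα hN _ c (hk c hc).1, digits'_count hα hN _ b (hk b hb).1] at h1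
      rcases h1.lt_or_eq with h2 | h2
      · exact (hk b hb).1.le.trans (not_lt.1 ((hk c hc).2 _ h2))
      · have hc' := (hk c hc).1
        simp only [← h2] at h hc'
        exact digits'_refl hα hN hf (k b) b (hk b hb).1 c hc' h

/-- There is no quasi-embedding from finite sequences of natural numbers with
Higman's embedding order into finite binary sequences with the weak gap
condition. -/
theorem no_quasiEmbedding_higman_into_weakGap_two :
    ¬ ∃ f : List ℕ → List Bool,
      ∀ s t : List ℕ, WeakGap (f s) (f t) →
        List.SublistForall₂ (· ≤ ·) s t := by
  rintro ⟨f0, hf0⟩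
  set f : List ℕ → List Bool := fun s => false :: f0 s with hfd
  have hf : ∀ s t, HH (f s) (f t) → Hig s t := fun s t h => hf0 s t h.weakGap_tail
  have hz : ∀ s, ZZ (f s) := fun s => Or.inr ⟨_, rfl⟩
  have hres : ∀ s t, ¬ Hig s t → Blk ((f s).length + 1) (f t) := by
    intro s t h
    rcases blk_or_hh (hz s) _ (f t) le_rfl (hz t) with h1 | h1
    · exact h1
    · exact absurd (hf _ _ h1) h
  set m := (f [0, 0]).length with hm
  obtain ⟨e, he1, he2⟩ := lower (m + 1)
  set w := f [m + 2] with hw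
  have hwB : Blk (m + 1) w := hres _ _ (fun h => by simpa using h.length)
  obtain ⟨c, hc⟩ := residual_small (blk_small m) (w.length + 1) hwB
  obtain ⟨γ, hγ, hR⟩ := hc.toRR
  have hγ' : γ < Ordinal.omega0 ^ (Ordinal.omega0 ^ ((m + 1 : ℕ) : Ordinal.{0})) :=
    hγ.trans_le (Ordinal.opow_le_opow_right Ordinal.omega0_pos
      (Order.add_one_le_of_lt (nmul'_lt m c)))
  refine hR.no_embed (fun b => f (e b)) ?_ ?_
  · intro b hb c hcb h
    exact absurd (he2 b (hb.trans_lt hγ') c ((hcb.le.trans hb).trans_lt hγ') (hf _ _ h))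
      (not_le.2 hcb)
  · intro b hb
    have hnot : ¬ Hig [m + 2] (e b) := fun h => h.top_false (he1 b (hb.trans_lt hγ'))
    exact ⟨hres _ _ hnot, fun h => hnot (hf _ _ h)⟩
end
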